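/- arXiv:2406.12988 — 6 statements merged into one kernel-verified Lean document; each statement's English description precedes it below -/
import Mathlib

section
/- Let p > 2. There exists a constant C > 0 such that for every Schwartz function u : ℝ² → ℂ one has P(u) ≤ C · X(u)^{(p−2)/4} · Y(u)^{(p−2)/8} · M(u)^{(p+6)/8}; equivalently, ‖u‖_{L^p(ℝ²)}^p ≤ C ‖∂_x u‖_{L²}^{(p−2)/2} ‖∂_yy u‖_{L²}^{(p−2)/4} ‖u‖_{L²}^{(p+6)/4} (the anisotropic Gagliardo–Nirenberg inequality). -/
open MeasureTheory

noncomputable section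

/-- Partial derivative in the first (x) variable. -/
def pdx (u : ℝ × ℝ → ℂ) : ℝ × ℝ → ℂ := fun z => deriv (fun x => u (x, z.2)) z.1

/-- Partial derivative in the second (y) variable. -/
def pdy (u : ℝ × ℝ → ℂ) : ℝ × ℝ → ℂ := fun z => deriv (fun y => u (z.1, y)) z.2

/-- Second partial derivative in x. -/
def pdxx (u : ℝ × ℝ → ℂ) : ℝ × ℝ → ℂ := pdx (pdx u)

/-- Second partial derivative in y. -/
def pdyy (u : ℝ × ℝ → ℂ) : ℝ × ℝ → ℂ := pdy (pdy u)

/-- Fourth partial derivative in y. -/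
def pdyyyy (u : ℝ × ℝ → ℂ) : ℝ × ℝ → ℂ := pdy (pdy (pdy (pdy u)))

/-- X(u) = ∫ |∂ₓ u|². -/
def Xf (u : ℝ × ℝ → ℂ) : ℝ := ∫ z : ℝ × ℝ, ‖pdx u z‖ ^ 2

/-- Y(u) = ∫ |∂_yy u|². -/
def Yf (u : ℝ × ℝ → ℂ) : ℝ := ∫ z : ℝ × ℝ, ‖pdyy u z‖ ^ 2

/-- M(u) = ∫ |u|². -/
def Mf (u : ℝ × ℝ → ℂ) : ℝ := ∫ z : ℝ × ℝ, ‖u z‖ ^ 2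

/-- P(u) = ∫ |u|ᵖ. -/
def Pf (p : ℝ) (u : ℝ × ℝ → ℂ) : ℝ := ∫ z : ℝ × ℝ, ‖u z‖ ^ p

/-- Energy E(u) = X(u)/2 + Y(u)/2 − P(u)/p. -/
def Ef (p : ℝ) (u : ℝ × ℝ → ℂ) : ℝ := Xf u / 2 + Yf u / 2 - Pf p u / p

/-- Action J_ω(u) = X(u)/2 + Y(u)/2 + (ω/2) M(u) − P(u)/p. -/
def Jf (p ω : ℝ) (u : ℝ × ℝ → ℂ) : ℝ := Xf u / 2 + Yf u / 2 + ω / 2 * Mf u - Pf p u / p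

/-- Standing wave equation −∂ₓₓu + ∂_yyyy u + ω u = |u|^{p−2} u pointwise. -/
def IsStandingWave (p ω : ℝ) (u : ℝ × ℝ → ℂ) : Prop :=
  ∀ z : ℝ × ℝ, -pdxx u z + pdyyyy u z + (ω : ℂ) * u z = ((‖u z‖ ^ (p - 2) : ℝ) : ℂ) * u z

/-- Mass-preserving anisotropic scaling u_λ(x,y) = λ^{3/8} u(λ^{1/2} x, λ^{1/4} y). -/
def uscale (l : ℝ) (u : ℝ × ℝ → ℂ) : ℝ × ℝ → ℂ :=
  fun z => ((l ^ ((3 : ℝ) / 8) : ℝ) : ℂ) * u (l ^ ((1 : ℝ) / 2) * z.1, l ^ ((1 : ℝ) / 4) * z.2)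

end

open scoped SchwartzMap LineDeriv

namespace SchwartzMap

section Inner

variable {E : Type*} [NormedAddCommGroup E] [NormedSpace ℝ E] [MeasurableSpace E] [BorelSpace E]

theorem integrable_norm_mul_norm (μ : Measure E) [μ.HasTemperateGrowth] (f g : 𝓢(E, ℂ)) :
    Integrable (fun x => ‖f x‖ * ‖g x‖) μ :=
  (f.memLp 2 μ).norm.integrable_mul (g.memLp 2 μ).norm

theorem integrable_real_inner [SecondCountableTopology E] (μ : Measure E) [μ.HasTemperateGrowth] (f g : 𝓢(E, ℂ)) :
    Integrable (fun x => inner ℝ (f x) (g x)) μ :=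
  (integrable_norm_mul_norm μ f g).mono'
    (f.continuous.inner g.continuous).aestronglyMeasurable
    (Filter.Eventually.of_forall fun _ => norm_inner_le_norm _ _)

theorem integral_norm_mul_norm_le (μ : Measure E) [μ.HasTemperateGrowth] (f g : 𝓢(E, ℂ)) :
    ∫ x, ‖f x‖ * ‖g x‖ ∂μ ≤ √(∫ x, ‖f x‖ ^ 2 ∂μ) * √(∫ x, ‖g x‖ ^ 2 ∂μ) := by
  have h := integral_mul_norm_le_Lp_mul_Lq (μ := μ) (f := f) (g := g) Real.HolderConjugate.two_two
    (by simpa using f.memLp 2 μ) (by simpa using g.memLp 2 μ)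
  simpa [Real.sqrt_eq_rpow] using h

end Inner

section Line

theorem norm_sq_eq_setIntegral_inner_deriv {f f' : 𝓢(ℝ, ℂ)} (h : ∀ t, HasDerivAt f (f' t) t)
    (a : ℝ) : ‖f a‖ ^ 2 = ∫ t in Set.Iic a, 2 * inner ℝ (f t) (f' t) := by
  have hlim : Filter.Tendsto (fun t => ‖f t‖ ^ 2) Filter.atBot (nhds 0) := by
    simpa using ((f.tendsto_cocompact.mono_left atBot_le_cocompact).norm.pow 2)
  rw [integral_Iic_of_hasDerivAt_of_tendsto' (fun t _ => (h t).norm_sq)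
    ((integrable_real_inner volume f f').const_mul 2).integrableOn hlim, sub_zero]

theorem norm_sq_le_sqrt_mul_sqrt {f f' : 𝓢(ℝ, ℂ)} (h : ∀ t, HasDerivAt f (f' t) t) (a : ℝ) :
    ‖f a‖ ^ 2 ≤ 2 * (√(∫ t, ‖f t‖ ^ 2) * √(∫ t, ‖f' t‖ ^ 2)) := by
  rw [norm_sq_eq_setIntegral_inner_deriv h, integral_const_mul]
  gcongr
  calc ∫ t in Set.Iic a, inner ℝ (f t) (f' t)
      ≤ ∫ t in Set.Iic a, ‖f t‖ * ‖f' t‖ :=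
        integral_mono (integrable_real_inner volume f f').integrableOn
          (integrable_norm_mul_norm volume f f').integrableOn fun t => real_inner_le_norm _ _
    _ ≤ ∫ t, ‖f t‖ * ‖f' t‖ :=
        setIntegral_le_integral (integrable_norm_mul_norm volume f f')
          (Filter.Eventually.of_forall fun t => by positivity)
    _ ≤ _ := integral_norm_mul_norm_le volume f f'

theorem integral_inner_deriv_right {f f' g g' : 𝓢(ℝ, ℂ)} (hf : ∀ t, HasDerivAt f (f' t) t)
    (hg : ∀ t, HasDerivAt g (g' t) t) :
    ∫ t, inner ℝ (f t) (g' t) = -∫ t, inner ℝ (f' t) (g t) :=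
  integral_bilinear_hasDerivAt_right_eq_neg_left_of_integrable (L := innerSL ℝ)
    (fun t _ => hf t) (fun t _ => hg t) (integrable_real_inner volume f g')
    (integrable_real_inner volume f' g) (integrable_real_inner volume f g)

end Line

section Plane

/-- The restriction `t ↦ f (t, y)` of a Schwartz function on the plane to a horizontal line. -/
noncomputable def horizontalSlice (f : 𝓢(ℝ × ℝ, ℂ)) (y : ℝ) : 𝓢(ℝ, ℂ) :=
  compCLMOfAntilipschitz (K := 1) ℝ (g := fun t : ℝ => (t, y))
    (by
      have : (fun t : ℝ => (t, y)) = fun t => ContinuousLinearMap.inl ℝ ℝ ℝ t + (0, y) := by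
        ext t <;> simp
      rw [this]
      exact (ContinuousLinearMap.hasTemperateGrowth _).add (.const _))
    (AntilipschitzWith.of_le_mul_dist fun s t => by simp [Prod.dist_eq]) f

/-- The restriction `t ↦ f (x, t)` of a Schwartz function on the plane to a vertical line. -/
noncomputable def verticalSlice (f : 𝓢(ℝ × ℝ, ℂ)) (x : ℝ) : 𝓢(ℝ, ℂ) :=
  compCLMOfAntilipschitz (K := 1) ℝ (g := fun t : ℝ => (x, t))
    (by
      have : (fun t : ℝ => (x, t)) = fun t => ContinuousLinearMap.inr ℝ ℝ ℝ t + (x, 0) := by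
        ext t <;> simp
      rw [this]
      exact (ContinuousLinearMap.hasTemperateGrowth _).add (.const _))
    (AntilipschitzWith.of_le_mul_dist fun s t => by simp [Prod.dist_eq]) f

@[simp]
theorem coe_horizontalSlice (f : 𝓢(ℝ × ℝ, ℂ)) (y : ℝ) :
    ⇑(f.horizontalSlice y) = fun t => f (t, y) := by
  ext t
  simp [horizontalSlice]

@[simp]
theorem coe_verticalSlice (f : 𝓢(ℝ × ℝ, ℂ)) (x : ℝ) :
    ⇑(f.verticalSlice x) = fun t => f (x, t) := by
  ext t
  simp [verticalSlice]

theorem hasDerivAt_horizontalSlice (f : 𝓢(ℝ × ℝ, ℂ)) (y t : ℝ) :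
    HasDerivAt (f.horizontalSlice y) ((∂_{((1, 0) : ℝ × ℝ)} f).horizontalSlice y t) t := by
  simp only [coe_horizontalSlice, lineDerivOp_apply_eq_fderiv]
  exact (f.hasFDerivAt (t, y)).comp_hasDerivAt t ((hasDerivAt_id t).prodMk (hasDerivAt_const t y))

theorem hasDerivAt_verticalSlice (f : 𝓢(ℝ × ℝ, ℂ)) (x t : ℝ) :
    HasDerivAt (f.verticalSlice x) ((∂_{((0, 1) : ℝ × ℝ)} f).verticalSlice x t) t := by
  simp only [coe_verticalSlice, lineDerivOp_apply_eq_fderiv]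
  exact (f.hasFDerivAt (x, t)).comp_hasDerivAt t ((hasDerivAt_const t x).prodMk (hasDerivAt_id t))

theorem pdx_eq (f : 𝓢(ℝ × ℝ, ℂ)) : pdx f = ∂_{((1, 0) : ℝ × ℝ)} f := by
  ext ⟨x, y⟩
  simpa [pdx] using (f.hasDerivAt_horizontalSlice y x).deriv

theorem pdy_eq (f : 𝓢(ℝ × ℝ, ℂ)) : pdy f = ∂_{((0, 1) : ℝ × ℝ)} f := by
  ext ⟨x, y⟩
  simpa [pdy] using (f.hasDerivAt_verticalSlice x y).deriv

theorem lineDerivOp_comm (f : 𝓢(ℝ × ℝ, ℂ)) (v w : ℝ × ℝ) : ∂_{v} (∂_{w} f) = ∂_{w} (∂_{v} f) := by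
  have key (a b z : ℝ × ℝ) : ∂_{a} (∂_{b} f) z = fderiv ℝ (fderiv ℝ f) z a b := by
    have hd : DifferentiableAt ℝ (fderiv ℝ f) z :=
      ((f.smooth 2).fderiv_right (m := 1) le_rfl).differentiable one_ne_zero z
    rw [lineDerivOp_apply_eq_fderiv,
      show ⇑(∂_{b} f : 𝓢(ℝ × ℝ, ℂ)) = fun z => fderiv ℝ f z b from
        funext fun z => lineDerivOp_apply_eq_fderiv b f z,
      fderiv_clm_apply hd (differentiableAt_const b)]
    simp
  ext z
  rw [key, key]
  exact ((f.smooth 2).contDiffAt.isSymmSndFDerivAt (by simp)) v w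

/-- If the vertical pairings of `f` with `∂₁ f` agree up to sign with those of `g` and `h`, then the
`L²` norm of `f` on any vertical line is controlled by the `L²` norms of `g` and `h`. -/
theorem integral_verticalSlice_norm_sq_le {f g h : 𝓢(ℝ × ℝ, ℂ)}
    (hfg : ∀ s, |∫ t, inner ℝ (f (s, t)) (∂_{((1, 0) : ℝ × ℝ)} f (s, t))| =
      |∫ t, inner ℝ (g (s, t)) (h (s, t))|) (x : ℝ) :
    ∫ t, ‖f (x, t)‖ ^ 2 ≤ 2 * (√(∫ z, ‖g z‖ ^ 2) * √(∫ z, ‖h z‖ ^ 2)) := by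
  set f' := ∂_{((1, 0) : ℝ × ℝ)} f
  have hi : Integrable (fun z : ℝ × ℝ => inner ℝ (f z) (f' z)) (volume.prod volume) :=
    integrable_real_inner volume f f'
  have hn : Integrable (fun z : ℝ × ℝ => ‖g z‖ * ‖h z‖) (volume.prod volume) :=
    integrable_norm_mul_norm volume g h
  have hslice (s : ℝ) : |∫ t, inner ℝ (f (s, t)) (f' (s, t))| ≤ ∫ t, ‖g (s, t)‖ * ‖h (s, t)‖ := by
    rw [hfg, ← Real.norm_eq_abs]
    refine norm_integral_le_of_norm_le ?_
      (Filter.Eventually.of_forall fun t => norm_inner_le_norm (𝕜 := ℝ) (g (s, t)) (h (s, t)))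
    simpa using integrable_norm_mul_norm volume (g.verticalSlice s) (h.verticalSlice s)
  calc ∫ t, ‖f (x, t)‖ ^ 2
      = ∫ t, ∫ s in Set.Iic x, 2 * inner ℝ (f (s, t)) (f' (s, t)) := by
        congr with t
        simpa using norm_sq_eq_setIntegral_inner_deriv (f.hasDerivAt_horizontalSlice t) x
    _ = 2 * ∫ s in Set.Iic x, ∫ t, inner ℝ (f (s, t)) (f' (s, t)) := by
        simp_rw [integral_const_mul]
        rw [integral_integral_swap]
        exact (hi.mono_measure (Measure.prod_mono Measure.restrict_le_self le_rfl)).swap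
    _ ≤ 2 * ∫ s in Set.Iic x, ∫ t, ‖g (s, t)‖ * ‖h (s, t)‖ := by
        refine mul_le_mul_of_nonneg_left ?_ zero_le_two
        exact integral_mono hi.integral_prod_left.integrableOn hn.integral_prod_left.integrableOn
          fun s => (le_abs_self _).trans (hslice s)
    _ ≤ 2 * ∫ s, ∫ t, ‖g (s, t)‖ * ‖h (s, t)‖ := by
        refine mul_le_mul_of_nonneg_left ?_ zero_le_two
        exact setIntegral_le_integral hn.integral_prod_left
          (Filter.Eventually.of_forall fun s => integral_nonneg fun t => by positivity)
    _ = 2 * ∫ z, ‖g z‖ * ‖h z‖ := by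
        rw [← integral_prod _ hn]; rfl
    _ ≤ _ := by
        gcongr
        exact integral_norm_mul_norm_le volume g h

theorem integral_verticalSlice_norm_sq_le_Mf_Xf (u : 𝓢(ℝ × ℝ, ℂ)) (x : ℝ) :
    ∫ t, ‖u (x, t)‖ ^ 2 ≤ 2 * (√(Mf u) * √(Xf u)) := by
  rw [Mf, Xf, pdx_eq]
  exact integral_verticalSlice_norm_sq_le (fun _ => rfl) x

theorem integral_verticalSlice_norm_sq_pdy_le_Yf_Xf (u : 𝓢(ℝ × ℝ, ℂ)) (x : ℝ) :
    ∫ t, ‖∂_{((0, 1) : ℝ × ℝ)} u (x, t)‖ ^ 2 ≤ 2 * (√(Yf u) * √(Xf u)) := by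
  rw [Yf, Xf, pdyy, pdy_eq, pdy_eq, pdx_eq]
  refine integral_verticalSlice_norm_sq_le (fun s => ?_) x
  rw [lineDerivOp_comm]
  have h := integral_inner_deriv_right
    ((∂_{((0, 1) : ℝ × ℝ)} u).hasDerivAt_verticalSlice s)
    ((∂_{((1, 0) : ℝ × ℝ)} u).hasDerivAt_verticalSlice s)
  simp only [coe_verticalSlice] at h
  rw [h, abs_neg]

theorem norm_sq_le_Xf_Yf_Mf (u : 𝓢(ℝ × ℝ, ℂ)) (z : ℝ × ℝ) :
    ‖u z‖ ^ 2 ≤ 4 * (√(Xf u) * √(√(Yf u)) * √(√(Mf u))) := by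
  obtain ⟨x, y⟩ := z
  have h := norm_sq_le_sqrt_mul_sqrt (u.hasDerivAt_verticalSlice x) y
  simp only [coe_verticalSlice] at h
  calc ‖u (x, y)‖ ^ 2
      ≤ 2 * (√(2 * (√(Mf u) * √(Xf u))) * √(2 * (√(Yf u) * √(Xf u)))) := by
        refine h.trans ?_
        gcongr
        · exact u.integral_verticalSlice_norm_sq_le_Mf_Xf x
        · exact u.integral_verticalSlice_norm_sq_pdy_le_Yf_Xf x
    _ = 2 * ((√2 * √2) * (√(√(Xf u)) * √(√(Xf u)) * √(√(Yf u)) * √(√(Mf u)))) := by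
        rw [Real.sqrt_mul zero_le_two, Real.sqrt_mul zero_le_two,
          Real.sqrt_mul (Real.sqrt_nonneg _), Real.sqrt_mul (Real.sqrt_nonneg _)]
        ring
    _ = _ := by
        rw [Real.mul_self_sqrt zero_le_two, Real.mul_self_sqrt (Real.sqrt_nonneg _)]
        ring

theorem Pf_le_mul_Mf {p B : ℝ} (hp : 2 ≤ p) (u : 𝓢(ℝ × ℝ, ℂ)) (hB : ∀ z, ‖u z‖ ^ 2 ≤ B) :
    Pf p u ≤ B ^ ((p - 2) / 2) * Mf u := by
  rw [Pf, Mf, ← integral_const_mul]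
  refine integral_mono_of_nonneg (Filter.Eventually.of_forall fun z => by positivity)
    ((u.memLp 2 volume).integrable_norm_pow two_ne_zero |>.const_mul _)
    (Filter.Eventually.of_forall fun z => ?_)
  calc ‖u z‖ ^ p = (‖u z‖ ^ 2) ^ ((p - 2) / 2) * ‖u z‖ ^ 2 := by
        rw [← Real.rpow_natCast, ← Real.rpow_mul (norm_nonneg _),
          ← Real.rpow_add_of_nonneg (norm_nonneg _) (by push_cast; linarith) (by positivity)]
        congr 1
        push_cast
        ring
    _ ≤ B ^ ((p - 2) / 2) * ‖u z‖ ^ 2 := by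
        gcongr
        exact hB z

end Plane

end SchwartzMap

/-- Anisotropic Gagliardo–Nirenberg inequality. -/
theorem stmt_0 (p : ℝ) (hp : 2 < p) :
    ∃ C > (0 : ℝ), ∀ u : SchwartzMap (ℝ × ℝ) ℂ,
      Pf p (fun z => u z) ≤
        C * Xf (fun z => u z) ^ ((p - 2) / 4) * Yf (fun z => u z) ^ ((p - 2) / 8)
          * Mf (fun z => u z) ^ ((p + 6) / 8) := by
  refine ⟨4 ^ ((p - 2) / 2), by positivity, fun u => ?_⟩
  have hX : 0 ≤ Xf u := integral_nonneg fun z => by positivity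
  have hY : 0 ≤ Yf u := integral_nonneg fun z => by positivity
  have hM : 0 ≤ Mf u := integral_nonneg fun z => by positivity
  refine (u.Pf_le_mul_Mf hp.le u.norm_sq_le_Xf_Yf_Mf).trans (le_of_eq ?_)
  rw [Real.mul_rpow (by positivity) (by positivity), Real.mul_rpow (by positivity) (by positivity),
    Real.mul_rpow (by positivity) (by positivity)]
  simp only [Real.sqrt_eq_rpow]
  rw [← Real.rpow_mul hX, ← Real.rpow_mul hY, ← Real.rpow_mul hY, ← Real.rpow_mul hM,
    ← Real.rpow_mul hM,
    show (p + 6) / 8 = 1 / 2 * (1 / 2) * ((p - 2) / 2) + 1 by ring,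
    Real.rpow_add_of_nonneg hM (by linarith) zero_le_one, Real.rpow_one]
  ring_nf
end

section
/- Let r > 0 and s ≥ 2 be real numbers with s > r + 1. For every Schwartz function f : ℝ → ℂ and every y ∈ ℝ, |f(y)|^s ≤ (s/√(2r+1)) · (∫_ℝ |f|^{2(s−r−1)} dτ)^{1/2} · (∫_ℝ |f|^{2(2r+1)} dτ)^{1/4} · (∫_ℝ |f''|² dτ)^{1/4}. -/
open MeasureTheory

open Filter Topology SchwartzMap

section HelperLemmas

variable {E : Type*} [NormedAddCommGroup E] [InnerProductSpace ℝ E]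

/-- The derivative of `‖u‖ ^ p * ⟪u, v⟫` where `v` is the derivative of `u`, valid also at the zeros
of `u`. -/
lemma hasDerivAt_norm_rpow_mul_inner {p : ℝ} (hp : 0 < p) {u v : ℝ → E} {w : E} {x : ℝ}
    (hu : HasDerivAt u (v x) x) (hv : HasDerivAt v w x) :
    HasDerivAt (fun t => ‖u t‖ ^ p * inner ℝ (u t) (v t))
      (p * (‖u x‖ ^ (p - 2) * inner ℝ (u x) (v x) ^ 2)
        + ‖u x‖ ^ p * (‖v x‖ ^ 2 + inner ℝ (u x) w)) x := by
  have hg : HasDerivAt (fun t => inner ℝ (u t) (v t)) _ x := hu.inner ℝ hv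
  by_cases h0 : u x = 0
  · have hk : Tendsto (fun t => ‖u t‖ ^ p) (𝓝 x) (𝓝 0) := by
      have := (hu.continuousAt.norm.rpow_const (p := p) (Or.inr hp.le)).tendsto
      simpa [h0, Real.zero_rpow hp.ne'] using this
    have := ((Asymptotics.isLittleO_one_iff ℝ).2 hk).mul_isBigO hg.isBigO_sub
    simp only [h0, inner_zero_left, norm_zero, Real.zero_rpow hp.ne', sub_zero] at this ⊢
    rw [hasDerivAt_iff_isLittleO]
    simpa [h0] using this
  · have hn : 0 < ‖u x‖ := norm_pos_iff.2 h0
    have hpow (y q : ℝ) (hy : 0 ≤ y) : (y ^ 2) ^ q = y ^ (2 * q) := by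
      rw [← Real.rpow_natCast, ← Real.rpow_mul hy]; norm_num
    have hk := hu.norm_sq.rpow_const (p := p / 2) (Or.inl (by positivity))
    simp only [hpow _ _ (norm_nonneg _)] at hk
    rw [show 2 * (p / 2) = p by ring, show 2 * (p / 2 - 1) = p - 2 by ring] at hk
    refine (hk.mul hg).congr_deriv ?_
    rw [real_inner_self_eq_norm_sq]
    ring

lemma rpow_sub_two_mul_sq_le {a b c p : ℝ} (ha : 0 ≤ a) (hp : 0 < p) (hc : |c| ≤ a * b) :
    a ^ (p - 2) * c ^ 2 ≤ a ^ p * b ^ 2 := by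
  rcases ha.eq_or_lt with rfl | ha
  · have : c = 0 := by simpa using hc
    simp [this, Real.zero_rpow hp.ne']
  · have h : c ^ 2 ≤ (a * b) ^ 2 := sq_le_sq.2 (hc.trans (le_abs_self _))
    calc a ^ (p - 2) * c ^ 2 ≤ a ^ (p - 2) * (a * b) ^ 2 := by gcongr
      _ = a ^ p * b ^ 2 := by
        rw [Real.rpow_sub ha, Real.rpow_two]; field_simp

/-- The Cauchy-Schwarz inequality for real integrals. -/
lemma integral_mul_le_rpow_half {α : Type*} [MeasurableSpace α] {μ : Measure α} {g h : α → ℝ}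
    (hg0 : ∀ x, 0 ≤ g x) (hh0 : ∀ x, 0 ≤ h x) (hg : MemLp g 2 μ) (hh : MemLp h 2 μ) :
    ∫ x, g x * h x ∂μ ≤
      (∫ x, g x ^ 2 ∂μ) ^ ((1 : ℝ) / 2) * (∫ x, h x ^ 2 ∂μ) ^ ((1 : ℝ) / 2) := by
  have := integral_mul_le_Lp_mul_Lq_of_nonneg (μ := μ) (p := 2) (q := 2)
    Real.HolderConjugate.two_two (ae_of_all _ hg0) (ae_of_all _ hh0)
    (by simpa using hg) (by simpa using hh)
  simpa only [Real.rpow_two] using this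

variable (f : 𝓢(ℝ, E))

lemma SchwartzMap.integrable_norm_rpow {p : ℝ} (hp : 0 < p) :
    Integrable fun t => ‖f t‖ ^ p := by
  have := (f.memLp (ENNReal.ofReal p)).integrable_norm_rpow (by simpa using hp) (by simp)
  simpa [ENNReal.toReal_ofReal hp.le] using this

lemma SchwartzMap.memLp_two_norm_rpow {p : ℝ} (hp : 0 < p) :
    MemLp (fun t => ‖f t‖ ^ p) 2 := by
  rw [memLp_two_iff_integrable_sq
    (f.continuous.norm.measurable.pow_const p).aestronglyMeasurable]
  refine (f.integrable_norm_rpow (p := p * 2) (by positivity)).congr (ae_of_all _ fun t => ?_)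
  simp [Real.rpow_mul (norm_nonneg _)]

lemma SchwartzMap.integrable_norm_rpow_mul {p : ℝ} (hp : 0 ≤ p) {g : ℝ → ℝ} (hg : Integrable g) :
    Integrable fun t => ‖f t‖ ^ p * g t := by
  obtain ⟨C, -, hC⟩ := f.decay 0 0
  refine hg.bdd_mul (c := C ^ p)
    (f.continuous.norm.measurable.pow_const p).aestronglyMeasurable (ae_of_all _ fun t => ?_)
  rw [Real.norm_of_nonneg (by positivity)]
  exact Real.rpow_le_rpow (norm_nonneg _) (by simpa using hC t) hp

lemma SchwartzMap.hasDerivAt_derivCLM (x : ℝ) : HasDerivAt f (derivCLM ℝ E f x) x :=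
  f.hasDerivAt x

lemma SchwartzMap.aestronglyMeasurable_norm_rpow_mul_inner (g : 𝓢(ℝ, E)) (p : ℝ) (n : ℕ) :
    AEStronglyMeasurable (fun t => ‖f t‖ ^ p * inner ℝ (f t) (g t) ^ n) :=
  (f.continuous.norm.measurable.pow_const p).aestronglyMeasurable.mul
    ((f.continuous.inner g.continuous).pow n).aestronglyMeasurable

lemma SchwartzMap.integrable_norm_sq : Integrable fun t => ‖f t‖ ^ 2 := by
  simpa using f.integrable_norm_rpow (p := 2) two_pos

lemma SchwartzMap.integrable_norm_rpow_mul_inner {p : ℝ} (hp : 0 ≤ p) (g : 𝓢(ℝ, E)) :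
    Integrable fun t => ‖f t‖ ^ p * inner ℝ (f t) (g t) := by
  refine f.integrable_norm_rpow_mul hp ?_
  refine (f.integrable_norm_rpow_mul zero_le_one g.integrable.norm).mono'
    (f.continuous.inner g.continuous).aestronglyMeasurable (ae_of_all _ fun t => ?_)
  simpa using norm_inner_le_norm (𝕜 := ℝ) (f t) (g t)

lemma SchwartzMap.integrable_norm_rpow_sub_two_mul_inner_sq {p : ℝ} (hp : 0 < p) (g : 𝓢(ℝ, E)) :
    Integrable fun t => ‖f t‖ ^ (p - 2) * inner ℝ (f t) (g t) ^ 2 := by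
  refine (f.integrable_norm_rpow_mul hp.le g.integrable_norm_sq).mono'
    (f.aestronglyMeasurable_norm_rpow_mul_inner g _ 2) (ae_of_all _ fun t => ?_)
  rw [Real.norm_of_nonneg (by positivity)]
  exact rpow_sub_two_mul_sq_le (norm_nonneg _) hp (abs_real_inner_le_norm _ _)

/-- The weighted energy estimate obtained by integrating by parts. -/
lemma SchwartzMap.integral_norm_rpow_sub_two_mul_inner_sq_le {p : ℝ} (hp : 0 < p) :
    (p + 1) * ∫ t, ‖f t‖ ^ (p - 2) * inner ℝ (f t) (derivCLM ℝ E f t) ^ 2 ≤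
      ∫ t, ‖f t‖ ^ (p + 1) * ‖derivCLM ℝ E (derivCLM ℝ E f) t‖ := by
  set v := derivCLM ℝ E f with hv
  set w := derivCLM ℝ E v with hw
  have hA := f.integrable_norm_rpow_sub_two_mul_inner_sq hp v
  have hB := f.integrable_norm_rpow_mul hp.le v.integrable_norm_sq
  have hC := f.integrable_norm_rpow_mul_inner hp.le w
  have hD : Integrable fun t => ‖f t‖ ^ (p + 1) * ‖w t‖ :=
    f.integrable_norm_rpow_mul (by positivity) w.integrable.norm
  have hder := integral_eq_zero_of_hasDerivAt_of_integrable
    (fun x => hasDerivAt_norm_rpow_mul_inner hp (f.hasDerivAt_derivCLM x)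
      (v.hasDerivAt_derivCLM x))
    (((hA.const_mul p).add (hB.add hC)).congr (ae_of_all _ fun t => by simp [mul_add, hv, hw]))
    (f.integrable_norm_rpow_mul_inner hp.le v)
  have hle : ∫ t, ((p + 1) * (‖f t‖ ^ (p - 2) * inner ℝ (f t) (v t) ^ 2)
      - ‖f t‖ ^ (p + 1) * ‖w t‖) ≤ 0 := by
    rw [← hder]
    refine integral_mono ((hA.const_mul _).sub hD)
      (((hA.const_mul p).add (hB.add hC)).congr
        (ae_of_all _ fun t => by simp [mul_add, hv, hw])) fun t => ?_
    have h1 := rpow_sub_two_mul_sq_le (norm_nonneg (f t)) hp (abs_real_inner_le_norm (f t) (v t))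
    have h2 : -(‖f t‖ * ‖w t‖) ≤ inner ℝ (f t) (w t) :=
      neg_le_of_abs_le (abs_real_inner_le_norm (f t) (w t))
    have h3 := mul_le_mul_of_nonneg_left h2 (Real.rpow_nonneg (norm_nonneg (f t)) p)
    rw [Real.rpow_add_one' (norm_nonneg _) (by positivity)]
    simp only [← hv, ← hw]
    linarith
  rw [integral_sub (hA.const_mul _) hD, integral_const_mul] at hle
  linarith

/-- The pointwise bound obtained by integrating the derivative of `‖f‖ ^ s` from `-∞`. -/
lemma SchwartzMap.norm_rpow_le_integral {s : ℝ} (hs : 2 ≤ s) (y : ℝ) :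
    ‖f y‖ ^ s ≤ s * ∫ t, ‖f t‖ ^ (s - 2) * |inner ℝ (f t) (derivCLM ℝ E f t)| := by
  have hint : Integrable fun t => ‖f t‖ ^ (s - 2) * inner ℝ (f t) (derivCLM ℝ E f t) :=
    f.integrable_norm_rpow_mul_inner (by linarith) _
  have hder (x : ℝ) : HasDerivAt (fun t => ‖f t‖ ^ s)
      (s * (‖f x‖ ^ (s - 2) * inner ℝ (f x) (derivCLM ℝ E f x))) x := by
    refine ((hasFDerivAt_norm_rpow (f x) (by linarith : 1 < s)).comp_hasDerivAt x
      (f.hasDerivAt_derivCLM x)).congr_deriv ?_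
    simp [mul_assoc]
  have hlim : Tendsto (fun t => ‖f t‖ ^ s) atBot (𝓝 0) := by
    have h : Tendsto f atBot (𝓝 0) := f.tendsto_cocompact.mono_left atBot_le_cocompact
    simpa [Real.zero_rpow (by linarith : s ≠ 0)] using
      h.norm.rpow_const (p := s) (Or.inr (by linarith))
  have h := integral_Iic_of_hasDerivAt_of_tendsto' (a := y) (fun x _ => hder x)
    (hint.const_mul s).integrableOn hlim
  rw [sub_zero, integral_const_mul] at h
  rw [← h]
  have habs : Integrable fun t => ‖f t‖ ^ (s - 2) * |inner ℝ (f t) (derivCLM ℝ E f t)| :=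
    hint.norm.congr (ae_of_all _ fun t => by
      simp [abs_of_nonneg (Real.rpow_nonneg (norm_nonneg (f t)) _)])
  refine mul_le_mul_of_nonneg_left ?_ (by linarith)
  refine (setIntegral_mono hint.integrableOn habs.integrableOn fun t => ?_).trans
    (setIntegral_le_integral habs (ae_of_all _ fun t => by positivity))
  exact mul_le_mul_of_nonneg_left (le_abs_self _) (by positivity)

lemma SchwartzMap.norm_rpow_le_mul_integral_rpow {r s : ℝ} (hr : 0 < r) (hs : 2 ≤ s)
    (hrs : r + 1 < s) (y : ℝ) :
    ‖f y‖ ^ s ≤ (s / Real.sqrt (2 * r + 1)) * (∫ t, ‖f t‖ ^ (2 * (s - r - 1))) ^ ((1 : ℝ) / 2)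
        * (∫ t, ‖f t‖ ^ (2 * (2 * r + 1))) ^ ((1 : ℝ) / 4)
        * (∫ t, ‖derivCLM ℝ E (derivCLM ℝ E f) t‖ ^ 2) ^ ((1 : ℝ) / 4) := by
  set v := derivCLM ℝ E f with hv
  set w := derivCLM ℝ E v with hw
  have hpow (p t : ℝ) : (‖f t‖ ^ p) ^ 2 = ‖f t‖ ^ (2 * p) := by
    rw [mul_comm, Real.rpow_mul (norm_nonneg _), Real.rpow_two]
  have hsq (t : ℝ) : (‖f t‖ ^ (r - 1) * |inner ℝ (f t) (v t)|) ^ 2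
      = ‖f t‖ ^ (2 * r - 2) * inner ℝ (f t) (v t) ^ 2 := by
    rw [mul_pow, hpow, sq_abs]; ring_nf
  have hq : MemLp (fun t => ‖f t‖ ^ (r - 1) * |inner ℝ (f t) (v t)|) 2 := by
    rw [memLp_two_iff_integrable_sq]
    · simpa only [hsq] using
        f.integrable_norm_rpow_sub_two_mul_inner_sq (p := 2 * r) (by positivity) v
    · exact (f.continuous.norm.measurable.pow_const _).aestronglyMeasurable.mul
        (f.continuous.inner v.continuous).abs.aestronglyMeasurable
  have hfactor (t : ℝ) : ‖f t‖ ^ (s - 2) * |inner ℝ (f t) (v t)|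
      = ‖f t‖ ^ (s - r - 1) * (‖f t‖ ^ (r - 1) * |inner ℝ (f t) (v t)|) := by
    by_cases h0 : f t = 0
    · simp [h0]
    · rw [← mul_assoc, ← Real.rpow_add (norm_pos_iff.2 h0)]; ring_nf
  have h1 := f.norm_rpow_le_integral hs y
  have h2 := integral_mul_le_rpow_half (fun t => by positivity) (fun t => by positivity)
    (f.memLp_two_norm_rpow (by linarith : 0 < s - r - 1)) hq
  have h3 := f.integral_norm_rpow_sub_two_mul_inner_sq_le (p := 2 * r) (by positivity)
  have h4 := integral_mul_le_rpow_half (fun t => by positivity) (fun t => norm_nonneg (w t))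
    (f.memLp_two_norm_rpow (by linarith : 0 < 2 * r + 1)) (w.memLp 2).norm
  simp only [← hv, ← hw, hfactor, hsq, hpow] at h1 h2 h3 h4
  set A := ∫ t, ‖f t‖ ^ (2 * r - 2) * inner ℝ (f t) (v t) ^ 2
  set I := ∫ t, ‖f t‖ ^ (2 * (s - r - 1))
  set J := ∫ t, ‖f t‖ ^ (2 * (2 * r + 1))
  set K := ∫ t, ‖w t‖ ^ 2
  have hA : 0 ≤ A := integral_nonneg fun t => by positivity
  have hI : 0 ≤ I := integral_nonneg fun t => by positivity
  have hJ : 0 ≤ J := integral_nonneg fun t => by positivity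
  have hK : 0 ≤ K := integral_nonneg fun t => by positivity
  have hA' : A ≤ J ^ ((1 : ℝ) / 2) * K ^ ((1 : ℝ) / 2) / (2 * r + 1) := by
    rw [le_div_iff₀ (by positivity)]
    linarith
  have hroot : A ^ ((1 : ℝ) / 2) ≤
      J ^ ((1 : ℝ) / 4) * K ^ ((1 : ℝ) / 4) / Real.sqrt (2 * r + 1) := by
    refine (Real.rpow_le_rpow hA hA' (by norm_num)).trans_eq ?_
    rw [Real.div_rpow (by positivity) (by positivity), Real.mul_rpow (by positivity)
      (by positivity), ← Real.rpow_mul hJ, ← Real.rpow_mul hK, Real.sqrt_eq_rpow]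
    norm_num
  calc ‖f y‖ ^ s ≤ s * (I ^ ((1 : ℝ) / 2) * A ^ ((1 : ℝ) / 2)) :=
        h1.trans (mul_le_mul_of_nonneg_left h2 (by linarith))
    _ ≤ s * (I ^ ((1 : ℝ) / 2) *
          (J ^ ((1 : ℝ) / 4) * K ^ ((1 : ℝ) / 4) / Real.sqrt (2 * r + 1))) := by gcongr
    _ = _ := by ring

end HelperLemmas

/-- One-dimensional inequality with second derivative. -/
theorem stmt_2 (r s : ℝ) (hr : 0 < r) (hs : 2 ≤ s) (hrs : r + 1 < s)
    (f : SchwartzMap ℝ ℂ) (y : ℝ) :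
    ‖f y‖ ^ s ≤
      (s / Real.sqrt (2 * r + 1)) * (∫ τ : ℝ, ‖f τ‖ ^ (2 * (s - r - 1))) ^ ((1 : ℝ) / 2)
        * (∫ τ : ℝ, ‖f τ‖ ^ (2 * (2 * r + 1))) ^ ((1 : ℝ) / 4)
        * (∫ τ : ℝ, ‖deriv (deriv (fun t => f t)) τ‖ ^ 2) ^ ((1 : ℝ) / 4) :=
  f.norm_rpow_le_mul_integral_rpow hr hs hrs y
end

section
/- Let p > 2 and ω ∈ ℝ. If u is a standing-wave solution, then Y(u) = ((p−2)/(4p)) · P(u) and X(u) = 2·Y(u); in particular the functional K(u) = Y(u)/2 − ((p−2)/(8p))·P(u) vanishes on standing-wave solutions. -/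
open MeasureTheory

open LineDeriv SchwartzMap

namespace SchwartzMap

variable {E : Type*} [NormedAddCommGroup E] [NormedSpace ℝ E]

/-- Directional derivatives of Schwartz functions commute. -/
theorem lineDerivOp_lineDerivOp_comm (v w : E) (f : 𝓢(E, ℂ)) :
    ∂_{v} (∂_{w} f) = ∂_{w} (∂_{v} f) := by
  ext z
  have hd : DifferentiableAt ℝ (fderiv ℝ f) z :=
    ((f.smooth 2).fderiv_right (m := 1) (by norm_num)).differentiable (by norm_num) z
  have key (a b : E) : ∂_{a} (∂_{b} f) z = fderiv ℝ (fderiv ℝ f) z a b := by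
    rw [lineDerivOp_apply_eq_fderiv,
      show (⇑(∂_{b} f : 𝓢(E, ℂ)) : E → ℂ) = fun y => fderiv ℝ f y b from rfl,
      fderiv_clm_apply hd (differentiableAt_const b)]
    simp
  rw [key, key]
  exact ((f.smooth 2).contDiffAt.isSymmSndFDerivAt (by simp)) v w

/-- Multiplication of a Schwartz function by a continuous linear functional. -/
noncomputable def linMul (L : E →L[ℝ] ℝ) (f : 𝓢(E, ℂ)) : 𝓢(E, ℂ) := smulLeftCLM ℂ L f

theorem linMul_apply (L : E →L[ℝ] ℝ) (f : 𝓢(E, ℂ)) (z : E) : linMul L f z = L z • f z :=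
  smulLeftCLM_apply_apply L.hasTemperateGrowth f z

theorem lineDerivOp_linMul (L : E →L[ℝ] ℝ) (v : E) (f : 𝓢(E, ℂ)) :
    ∂_{v} (linMul L f) = L v • f + linMul L (∂_{v} f) := by
  ext z
  rw [lineDerivOp_apply_eq_fderiv,
    show (⇑(linMul L f) : E → ℂ) = fun y => L y • f y from funext (linMul_apply L f),
    fderiv_fun_smul L.differentiableAt f.differentiableAt]
  simp [linMul_apply, lineDerivOp_apply_eq_fderiv, add_comm]

theorem exists_norm_rpow_le_mul_norm {p : ℝ} (hp : 1 ≤ p) (f : 𝓢(E, ℂ)) :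
    ∃ C, ∀ z, ‖f z‖ ^ p ≤ C * ‖f z‖ := by
  refine ⟨(SchwartzMap.seminorm ℝ 0 0 f) ^ (p - 1), fun z => ?_⟩
  have h : ‖f z‖ ^ p = ‖f z‖ ^ (p - 1) * ‖f z‖ := by
    rw [← Real.rpow_add_one' (norm_nonneg _) (by linarith), sub_add_cancel]
  rw [h]
  gcongr
  exact norm_le_seminorm ℝ f z

variable [FiniteDimensional ℝ E] [MeasurableSpace E] [BorelSpace E]
  (μ : Measure E) [μ.IsAddHaarMeasure]

/-- The real `L²` pairing of complex-valued Schwartz functions. -/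
noncomputable def realInner : 𝓢(E, ℂ) →ₗ[ℝ] 𝓢(E, ℂ) →ₗ[ℝ] ℝ :=
  LinearMap.mk₂ ℝ (fun f g => ∫ z, pairing (innerSL ℝ) f g z ∂μ)
    (fun f f' g => by
      rw [← integral_add (integrable _) (integrable _)]
      simp)
    (fun c f g => by
      rw [← integral_smul]
      simp)
    (fun f g g' => by
      rw [← integral_add (integrable _) (integrable _)]
      simp)
    (fun c f g => by
      rw [← integral_smul]
      simp)

theorem realInner_apply (f g : 𝓢(E, ℂ)) :
    realInner μ f g = ∫ z, inner ℝ (f z) (g z) ∂μ := rfl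

theorem realInner_comm (f g : 𝓢(E, ℂ)) : realInner μ f g = realInner μ g f := by
  simp only [realInner_apply]
  exact integral_congr_ae (.of_forall fun z => real_inner_comm (g z) (f z))

theorem realInner_self (f : 𝓢(E, ℂ)) : realInner μ f f = ∫ z, ‖f z‖ ^ 2 ∂μ := by
  simp only [realInner_apply, real_inner_self_eq_norm_sq]

theorem realInner_lineDerivOp_left (v : E) (f g : 𝓢(E, ℂ)) :
    realInner μ (∂_{v} f) g = -realInner μ f (∂_{v} g) := by
  have h : realInner μ f (∂_{v} g) = -realInner μ (∂_{v} f) g :=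
    integral_bilinear_lineDerivOp_right_eq_neg_left f g (innerSL ℝ) v
  rw [h, neg_neg]

theorem realInner_linMul_left (L : E →L[ℝ] ℝ) (f g : 𝓢(E, ℂ)) :
    realInner μ (linMul L f) g = realInner μ f (linMul L g) := by
  simp only [realInner_apply, linMul_apply, real_inner_smul_left, real_inner_smul_right]

theorem realInner_linMul_lineDerivOp (L : E →L[ℝ] ℝ) (v : E) (f : 𝓢(E, ℂ)) :
    realInner μ f (linMul L (∂_{v} f)) = -(L v / 2) * realInner μ f f := by
  have h := realInner_lineDerivOp_left μ v f (linMul L f)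
  rw [lineDerivOp_linMul, map_add, map_smul, smul_eq_mul, realInner_comm, realInner_linMul_left] at h
  linarith

theorem integrable_norm_rpow_s8 {p : ℝ} (hp : 1 ≤ p) (f : 𝓢(E, ℂ)) :
    Integrable (fun z => ‖f z‖ ^ p) μ := by
  obtain ⟨C, hC⟩ := exists_norm_rpow_le_mul_norm hp f
  refine (f.integrable (μ := μ)).norm.const_mul C |>.mono'
    (f.continuous.norm.rpow_const fun _ => .inr (by linarith)).aestronglyMeasurable
    (.of_forall fun z => ?_)
  rw [Real.norm_of_nonneg (by positivity)]
  exact hC z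

theorem integrable_linear_mul_norm_rpow {p : ℝ} (hp : 1 ≤ p) (L : E →L[ℝ] ℝ) (f : 𝓢(E, ℂ)) :
    Integrable (fun z => L z * ‖f z‖ ^ p) μ := by
  obtain ⟨C, hC⟩ := exists_norm_rpow_le_mul_norm hp f
  refine ((linMul L f).integrable (μ := μ)).norm.const_mul C |>.mono'
    (L.continuous.mul
      (f.continuous.norm.rpow_const fun _ => .inr (by linarith))).aestronglyMeasurable
    (.of_forall fun z => ?_)
  rw [norm_mul, Real.norm_of_nonneg (Real.rpow_nonneg (norm_nonneg _) p), linMul_apply,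
    norm_smul, mul_left_comm]
  exact mul_le_mul_of_nonneg_left (hC z) (norm_nonneg _)

/-- If a Schwartz function `g` equals `|f|^{p-2} f`, then pairing it with `f` gives `∫ |f|^p`. -/
theorem realInner_of_eq_norm_rpow_smul {p : ℝ} (hp : 1 < p) {f g : 𝓢(E, ℂ)}
    (hg : ∀ z, g z = ‖f z‖ ^ (p - 2) • f z) :
    realInner μ g f = ∫ z, ‖f z‖ ^ p ∂μ := by
  rw [realInner_apply]
  congr 1 with z
  rw [hg, real_inner_smul_left, real_inner_self_eq_norm_sq, ← Real.rpow_natCast,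
    ← Real.rpow_add' (norm_nonneg _) (by push_cast; linarith)]
  congr 1
  push_cast
  ring

/-- If a Schwartz function `g` equals `|f|^{p-2} f`, then pairing it with `L ∂_v f` gives
a multiple of `∫ |f|^p`, since `|f|^{p-2} ⟪f, ∂_v f⟫ = ∂_v (|f|^p) / p`. -/
theorem realInner_linMul_lineDerivOp_of_eq_norm_rpow_smul {p : ℝ} (hp : 1 < p)
    {f g : 𝓢(E, ℂ)} (hg : ∀ z, g z = ‖f z‖ ^ (p - 2) • f z) (L : E →L[ℝ] ℝ) (v : E) :
    realInner μ g (linMul L (∂_{v} f)) = -(L v / p) * ∫ z, ‖f z‖ ^ p ∂μ := by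
  have hderiv (z : E) : HasFDerivAt (fun y => ‖f y‖ ^ p)
      (((p * ‖f z‖ ^ (p - 2)) • innerSL ℝ (f z)).comp (fderiv ℝ f z)) z :=
    (hasFDerivAt_norm_rpow (f z) hp).comp z f.differentiableAt.hasFDerivAt
  have hval (z : E) : L z * (((p * ‖f z‖ ^ (p - 2)) • innerSL ℝ (f z)).comp (fderiv ℝ f z)) v
      = p * pairing (innerSL ℝ) g (linMul L (∂_{v} f)) z := by
    rw [pairing_apply_apply, innerSL_apply_apply, hg, linMul_apply, real_inner_smul_left,
      real_inner_smul_right, lineDerivOp_apply_eq_fderiv, ContinuousLinearMap.comp_apply,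
      smul_apply, innerSL_apply_apply, smul_eq_mul]
    ring
  have h := integral_bilinear_hasFDerivAt_right_eq_neg_left_of_integrable (μ := μ)
    (f := L) (f' := fun _ => L) (g := fun y => ‖f y‖ ^ p) (v := v)
    (g' := fun z => ((p * ‖f z‖ ^ (p - 2)) • innerSL ℝ (f z)).comp (fderiv ℝ f z))
    (B := ContinuousLinearMap.mul ℝ ℝ)
    (by simpa using (integrable_norm_rpow_s8 μ hp.le f).const_mul (L v))
    (by
      simp only [ContinuousLinearMap.mul_apply', hval]
      exact (integrable _).const_mul p)
    (by simpa using integrable_linear_mul_norm_rpow μ hp.le L f)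
    (fun z _ => L.hasFDerivAt) (fun z _ => hderiv z)
  simp only [ContinuousLinearMap.mul_apply', hval, integral_const_mul] at h
  have h' : p * realInner μ g (linMul L (∂_{v} f)) = -(L v * ∫ z, ‖f z‖ ^ p ∂μ) := h
  field_simp
  linarith

end SchwartzMap

theorem pdx_schwartz (f : 𝓢(ℝ × ℝ, ℂ)) : pdx f = ∂_{((1 : ℝ), (0 : ℝ))} f := by
  funext z
  rw [lineDerivOp_apply_eq_fderiv, pdx]
  have h : HasDerivAt (fun x : ℝ => (x, z.2)) ((1 : ℝ), (0 : ℝ)) z.1 :=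
    (hasDerivAt_id _).prodMk (hasDerivAt_const _ _)
  exact (f.differentiableAt.hasFDerivAt.comp_hasDerivAt z.1 h).deriv

theorem pdy_schwartz (f : 𝓢(ℝ × ℝ, ℂ)) : pdy f = ∂_{((0 : ℝ), (1 : ℝ))} f := by
  funext z
  rw [lineDerivOp_apply_eq_fderiv, pdy]
  have h : HasDerivAt (fun y : ℝ => (z.1, y)) ((0 : ℝ), (1 : ℝ)) z.2 :=
    (hasDerivAt_const _ _).prodMk (hasDerivAt_id _)
  exact (f.differentiableAt.hasFDerivAt.comp_hasDerivAt z.2 h).deriv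

/-- Y(u) = ((p−2)/(4p)) P(u), X(u) = 2 Y(u), and K(u) = 0 for standing waves. -/
theorem stmt_8 (p ω : ℝ) (hp : 2 < p) (u : SchwartzMap (ℝ × ℝ) ℂ)
    (hu : IsStandingWave p ω (fun z => u z)) :
    Yf (fun z => u z) = ((p - 2) / (4 * p)) * Pf p (fun z => u z)
      ∧ Xf (fun z => u z) = 2 * Yf (fun z => u z)
      ∧ Yf (fun z => u z) / 2 - ((p - 2) / (8 * p)) * Pf p (fun z => u z) = 0 := by
  let ex : ℝ × ℝ := (1, 0)
  let ey : ℝ × ℝ := (0, 1)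
  let Lx : ℝ × ℝ →L[ℝ] ℝ := ContinuousLinearMap.fst ℝ ℝ ℝ
  let Ly : ℝ × ℝ →L[ℝ] ℝ := ContinuousLinearMap.snd ℝ ℝ ℝ
  have hxx : Lx ex = 1 := rfl
  have hxy : Lx ey = 0 := rfl
  have hyx : Ly ex = 0 := rfl
  have hyy : Ly ey = 1 := rfl
  let I := realInner (volume : Measure (ℝ × ℝ))
  let W : 𝓢(ℝ × ℝ, ℂ) := -∂_{ex} (∂_{ex} u) + ∂_{ey} (∂_{ey} (∂_{ey} (∂_{ey} u))) + ω • u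
  have hW (z : ℝ × ℝ) : W z = ‖u z‖ ^ (p - 2) • u z := by
    have h := hu z
    simp only [pdxx, pdyyyy, pdx_schwartz, pdy_schwartz] at h
    rw [Complex.real_smul, ← h]
    simp [W, ex, ey]
  have hX : Xf (fun z => u z) = I (∂_{ex} u) (∂_{ex} u) := by
    rw [realInner_self]
    simp only [Xf, pdx_schwartz]
    rfl
  have hY : Yf (fun z => u z) = I (∂_{ey} (∂_{ey} u)) (∂_{ey} (∂_{ey} u)) := by
    rw [realInner_self]
    simp only [Yf, pdyy, pdy_schwartz]
    rfl
  have hWI (g : 𝓢(ℝ × ℝ, ℂ)) : I W g =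
      I (∂_{ex} u) (∂_{ex} g) + I (∂_{ey} (∂_{ey} u)) (∂_{ey} (∂_{ey} g)) + ω * I u g := by
    simp only [W, map_add, map_neg, map_smul, LinearMap.add_apply, LinearMap.neg_apply,
      LinearMap.smul_apply, smul_eq_mul, I, realInner_lineDerivOp_left, neg_neg]
  have hP : Pf p (fun z => u z) = ∫ z, ‖u z‖ ^ p := rfl
  have nehari : I W u = _ := realInner_of_eq_norm_rpow_smul volume (by linarith) hW
  have pohozaev_x : I W (linMul Lx (∂_{ex} u)) = _ :=
    realInner_linMul_lineDerivOp_of_eq_norm_rpow_smul volume (by linarith) hW Lx ex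
  have pohozaev_y : I W (linMul Ly (∂_{ey} u)) = _ :=
    realInner_linMul_lineDerivOp_of_eq_norm_rpow_smul volume (by linarith) hW Ly ey
  have virial (L : ℝ × ℝ →L[ℝ] ℝ) (v : ℝ × ℝ) (f : 𝓢(ℝ × ℝ, ℂ)) :
      I f (linMul L (∂_{v} f)) = -(L v / 2) * I f f := realInner_linMul_lineDerivOp volume L v f
  rw [hWI, ← hX, ← hY, ← hP] at nehari
  have hcomm (f : 𝓢(ℝ × ℝ, ℂ)) : ∂_{ey} (∂_{ex} f) = ∂_{ex} (∂_{ey} f) :=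
    lineDerivOp_lineDerivOp_comm ey ex f
  simp only [hWI, lineDerivOp_linMul, hxx, hxy, zero_smul, one_smul, zero_add, map_add, virial,
    hcomm, ← hX, ← hY, ← hP] at pohozaev_x
  simp only [hWI, lineDerivOp_linMul, lineDerivOp_add, hyx, hyy, zero_smul, one_smul, zero_add,
    map_add, virial, ← hcomm, ← hX, ← hY, ← hP] at pohozaev_y
  have hp0 : p ≠ 0 := by linarith
  have hXY : Xf (fun z => u z) = 2 * Yf (fun z => u z) := by linarith
  have hYP : Yf (fun z => u z) = ((p - 2) / (4 * p)) * Pf p (fun z => u z) := by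
    have h : (p - 2) / (4 * p) * Pf p (fun z => u z)
        = Pf p (fun z => u z) / 4 - 1 / p * Pf p (fun z => u z) / 2 := by
      field_simp
      ring
    linarith
  refine ⟨hYP, hXY, ?_⟩
  rw [hYP]
  field_simp
  ring
end

section
/- Let 2 < p < 14/3 and c > 0. Then there exists B ∈ ℝ such that every Schwartz function u : ℝ² → ℂ with M(u) = c satisfies E(u) ≥ B; that is, the constrained energy infimum m(c) is finite. -/
open MeasureTheory

open SchwartzMap Filter Topology
open scoped LineDeriv

/-- Products of powers of Schwartz functions are integrable. -/
theorem integrable_norm_pow_mul_norm {E : Type*} [NormedAddCommGroup E] [NormedSpace ℝ E]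
    [MeasurableSpace E] [BorelSpace E] [SecondCountableTopology E]
    {μ : Measure E} [μ.HasTemperateGrowth] (u w : 𝓢(E, ℂ)) (k : ℕ) :
    Integrable (fun z => ‖u z‖ ^ k * ‖w z‖) μ := by
  obtain ⟨C, -, hC⟩ := u.decay 0 0
  refine (w.integrable (μ := μ)).norm.bdd_mul (c := C ^ k)
    (by have := u.continuous; fun_prop) (ae_of_all _ fun z => ?_)
  have h : ‖u z‖ ≤ C := by simpa using hC z
  rw [norm_pow, norm_norm]
  gcongr

theorem integrable_norm_pow_succ {E : Type*} [NormedAddCommGroup E] [NormedSpace ℝ E]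
    [MeasurableSpace E] [BorelSpace E] [SecondCountableTopology E]
    {μ : Measure E} [μ.HasTemperateGrowth] (u : 𝓢(E, ℂ)) (k : ℕ) :
    Integrable (fun z => ‖u z‖ ^ (k + 1)) μ := by
  simpa only [pow_succ] using integrable_norm_pow_mul_norm u u k

/-- The restriction of a Schwartz function to an affine line is Schwartz. -/
theorem exists_schwartzMap_eq_comp_line {E : Type*} [NormedAddCommGroup E] [NormedSpace ℝ E]
    (u : 𝓢(E, ℂ)) (z v : E) (hv : ‖v‖ = 1) :
    ∃ w : 𝓢(ℝ, ℂ), ∀ t, w t = u (z + t • v) := by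
  have hg : (fun t : ℝ => z + t • v).HasTemperateGrowth :=
    (Function.HasTemperateGrowth.const z).add
      ((ContinuousLinearMap.toSpanSingleton ℝ v).hasTemperateGrowth)
  have ha : AntilipschitzWith 1 (fun t : ℝ => z + t • v) :=
    AntilipschitzWith.of_le_mul_dist fun s t => by
      simp [dist_eq_norm, ← sub_smul, norm_smul, hv]
  exact ⟨compCLMOfAntilipschitz ℝ hg ha u, fun t => rfl⟩

theorem hasDerivAt_comp_line {E : Type*} [NormedAddCommGroup E] [NormedSpace ℝ E]
    (u : 𝓢(E, ℂ)) (z v : E) (t : ℝ) :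
    HasDerivAt (fun t : ℝ => u (z + t • v)) (∂_{v} u (z + t • v)) t := by
  rw [lineDerivOp_apply_eq_fderiv]
  refine (u.differentiableAt (x := z + t • v)).hasFDerivAt.comp_hasDerivAt t ?_
  simpa using ((hasDerivAt_id t).smul_const v).const_add z

/-- The fundamental theorem of calculus for even powers of a Schwartz function along a line. -/
theorem norm_pow_le_integral_line {E : Type*} [NormedAddCommGroup E] [NormedSpace ℝ E]
    (u : 𝓢(E, ℂ)) (z v : E) (hv : ‖v‖ = 1) (n : ℕ) (s : ℝ) :
    ‖u (z + s • v)‖ ^ (2 * n + 2) ≤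
      (2 * n + 2) * ∫ t : ℝ, ‖u (z + t • v)‖ ^ (2 * n + 1) * ‖∂_{v} u (z + t • v)‖ := by
  obtain ⟨w, hw⟩ := exists_schwartzMap_eq_comp_line u z v hv
  obtain ⟨w', hw'⟩ := exists_schwartzMap_eq_comp_line (∂_{v} u) z v hv
  have hd (t : ℝ) : HasDerivAt w (w' t) t := by
    rw [hw', funext hw]
    exact hasDerivAt_comp_line u z v t
  simp only [← hw, ← hw']
  have hint := integrable_norm_pow_mul_norm (μ := volume) w w' (2 * n + 1)
  have hdn (t : ℝ) : HasDerivAt (fun t => (‖w t‖ ^ 2) ^ (n + 1))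
      ((n + 1 : ℕ) * (‖w t‖ ^ 2) ^ n * (2 * inner ℝ (w t) (w' t))) t := by
    exact (hd t).norm_sq.fun_pow (n + 1)
  have hbound (t : ℝ) : ‖(n + 1 : ℕ) * (‖w t‖ ^ 2) ^ n * (2 * inner ℝ (w t) (w' t))‖ ≤
      (2 * n + 2) * (‖w t‖ ^ (2 * n + 1) * ‖w' t‖) := by
    have h := norm_inner_le_norm (𝕜 := ℝ) (w t) (w' t)
    calc _ = (2 * n + 2) * ‖w t‖ ^ (2 * n) * ‖inner ℝ (w t) (w' t)‖ := by
          simp only [norm_mul, norm_pow, norm_norm, Real.norm_natCast, Real.norm_ofNat, pow_mul]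
          push_cast
          ring
      _ ≤ (2 * n + 2) * ‖w t‖ ^ (2 * n) * (‖w t‖ * ‖w' t‖) := by gcongr
      _ = _ := by ring
  have hint' : Integrable
      (fun t => (n + 1 : ℕ) * (‖w t‖ ^ 2) ^ n * (2 * inner ℝ (w t) (w' t))) := by
    refine (hint.const_mul (2 * n + 2 : ℝ)).mono' ?_ (ae_of_all _ hbound)
    have := w.continuous
    have := w'.continuous
    fun_prop
  have hlim : Tendsto (fun t => (‖w t‖ ^ 2) ^ (n + 1)) atBot (𝓝 0) := by
    have h : Tendsto w atBot (𝓝 0) :=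
      w.tendsto_cocompact.mono_left atBot_le_cocompact
    simpa using (h.norm.pow 2).pow (n + 1)
  have hftc := integral_Iic_of_hasDerivAt_of_tendsto' (a := s) (fun t _ => hdn t)
    hint'.integrableOn hlim
  calc ‖w s‖ ^ (2 * n + 2) = (‖w s‖ ^ 2) ^ (n + 1) - 0 := by ring
    _ ≤ ‖∫ t in Set.Iic s, (n + 1 : ℕ) * (‖w t‖ ^ 2) ^ n * (2 * inner ℝ (w t) (w' t))‖ := by
        rw [← hftc]; exact le_abs_self _
    _ ≤ ∫ t in Set.Iic s, (2 * n + 2) * (‖w t‖ ^ (2 * n + 1) * ‖w' t‖) :=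
        norm_integral_le_of_norm_le (hint.const_mul _).integrableOn (ae_of_all _ hbound)
    _ ≤ ∫ t, (2 * n + 2) * (‖w t‖ ^ (2 * n + 1) * ‖w' t‖) :=
        setIntegral_le_integral (hint.const_mul _) (ae_of_all _ fun t => by positivity)
    _ = _ := integral_const_mul _ _

/-- The Cauchy-Schwarz inequality for real integrals. -/
theorem sq_integral_mul_le {α : Type*} [MeasurableSpace α] {μ : Measure α} {f g : α → ℝ}
    (hf : Integrable (fun z => f z ^ 2) μ) (hg : Integrable (fun z => g z ^ 2) μ)
    (hfg : Integrable (fun z => f z * g z) μ) :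
    (∫ z, f z * g z ∂μ) ^ 2 ≤ (∫ z, f z ^ 2 ∂μ) * ∫ z, g z ^ 2 ∂μ := by
  have h (t : ℝ) : 0 ≤ (∫ z, g z ^ 2 ∂μ) * (t * t) + (2 * ∫ z, f z * g z ∂μ) * t
      + ∫ z, f z ^ 2 ∂μ := by
    calc 0 ≤ ∫ z, (f z + t * g z) ^ 2 ∂μ := integral_nonneg fun z => sq_nonneg _
      _ = ∫ z, (t * t) * g z ^ 2 + (2 * t) * (f z * g z) + f z ^ 2 ∂μ := by
          congr 1 with z; ring
      _ = _ := by
          have h1 := hg.const_mul (t * t)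
          have h2 := hfg.const_mul (2 * t)
          have h12 : Integrable (fun z => t * t * g z ^ 2 + 2 * t * (f z * g z)) μ := h1.add h2
          rw [integral_add h12 hf, integral_add h1 h2, integral_const_mul,
            integral_const_mul]
          ring
  have := discrim_le_zero h
  rw [discrim] at this
  linarith

theorem pdx_eq_lineDerivOp (u : 𝓢(ℝ × ℝ, ℂ)) : pdx u = ∂_{((1 : ℝ), (0 : ℝ))} u := by
  funext z
  simpa [pdx] using (hasDerivAt_comp_line u (0, z.2) (1, 0) z.1).deriv

theorem pdy_eq_lineDerivOp (u : 𝓢(ℝ × ℝ, ℂ)) : pdy u = ∂_{((0 : ℝ), (1 : ℝ))} u := by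
  funext z
  simpa [pdy] using (hasDerivAt_comp_line u (z.1, 0) (0, 1) z.2).deriv

theorem pdyy_eq_lineDerivOp (u : 𝓢(ℝ × ℝ, ℂ)) :
    pdyy u = ∂_{((0 : ℝ), (1 : ℝ))} (∂_{((0 : ℝ), (1 : ℝ))} u) := by
  rw [pdyy, pdy_eq_lineDerivOp, pdy_eq_lineDerivOp]

/-- Interpolation of the first derivative between a function and its second derivative. -/
theorem sq_integral_norm_pdy_sq_le (u : 𝓢(ℝ × ℝ, ℂ)) :
    (∫ z, ‖pdy u z‖ ^ 2) ^ 2 ≤ Mf u * Yf u := by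
  rw [Mf, Yf, pdyy_eq_lineDerivOp, pdy_eq_lineDerivOp]
  set v : ℝ × ℝ := (0, 1)
  have hparts : ∫ z, ‖∂_{v} u z‖ ^ 2 = -∫ z, inner ℝ (∂_{v} (∂_{v} u) z) (u z) := by
    simp only [← real_inner_self_eq_norm_sq]
    exact integral_bilinear_lineDerivOp_right_eq_neg_left (∂_{v} u) u (innerSL ℝ) v
  have hint := integrable_norm_pow_mul_norm (μ := volume) u (∂_{v} (∂_{v} u)) 1
  simp only [pow_one] at hint
  have hle : ∫ z, ‖∂_{v} u z‖ ^ 2 ≤ ∫ z, ‖u z‖ * ‖∂_{v} (∂_{v} u) z‖ := by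
    rw [hparts, ← integral_neg]
    refine (Real.le_norm_self _).trans
      (norm_integral_le_of_norm_le hint (ae_of_all _ fun z => ?_))
    rw [norm_neg, mul_comm]
    exact norm_inner_le_norm _ _
  calc _ ≤ (∫ z, ‖u z‖ * ‖∂_{v} (∂_{v} u) z‖) ^ 2 :=
        pow_le_pow_left₀ (integral_nonneg fun z => by positivity) hle 2
    _ ≤ _ := sq_integral_mul_le (integrable_norm_pow_succ u 1) (integrable_norm_pow_succ _ 1) hint

/-- An anisotropic Ladyzhenskaya inequality for the sixth power. -/
theorem integral_norm_pow_six_le (u : 𝓢(ℝ × ℝ, ℂ)) :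
    ∫ z, ‖u z‖ ^ 6 ≤ 64 * Mf u * Xf u * ∫ z, ‖pdy u z‖ ^ 2 := by
  rw [Mf, Xf, pdx_eq_lineDerivOp, pdy_eq_lineDerivOp]
  set ux := ∂_{((1 : ℝ), (0 : ℝ))} u
  set uy := ∂_{((0 : ℝ), (1 : ℝ))} u
  have hAint := integrable_norm_pow_mul_norm (μ := volume) u ux 1
  have hBint := integrable_norm_pow_mul_norm (μ := volume) u uy 3
  set a : ℝ → ℝ := fun y => ∫ x, ‖u (x, y)‖ ^ 1 * ‖ux (x, y)‖ with ha_def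
  set b : ℝ → ℝ := fun x => ∫ y, ‖u (x, y)‖ ^ 3 * ‖uy (x, y)‖ with hb_def
  have ha (z : ℝ × ℝ) : ‖u z‖ ^ 2 ≤ 2 * a z.2 := by
    simpa [ha_def] using norm_pow_le_integral_line u (0, z.2) (1, 0) (by simp [Prod.norm_def]) 0 z.1
  have hb (z : ℝ × ℝ) : ‖u z‖ ^ 4 ≤ 4 * b z.1 := by
    have := norm_pow_le_integral_line u (z.1, 0) (0, 1) (by simp [Prod.norm_def]) 1 z.2
    norm_num at this
    simpa [hb_def] using this
  have haint : Integrable a := hAint.integral_prod_right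
  have hbint : Integrable b := hBint.integral_prod_left
  have hA : ∫ y, a y = ∫ z, ‖u z‖ ^ 1 * ‖ux z‖ := (integral_prod_symm _ hAint).symm
  have hB : ∫ x, b x = ∫ z, ‖u z‖ ^ 3 * ‖uy z‖ := (integral_prod _ hBint).symm
  have hprod : ∫ z, ‖u z‖ ^ 6 ≤ 8 * ((∫ x, b x) * ∫ y, a y) := by
    rw [← integral_prod_mul, ← integral_const_mul]
    refine integral_mono (integrable_norm_pow_succ u 5)
      ((hbint.mul_prod haint).const_mul 8) fun z => ?_
    calc ‖u z‖ ^ 6 = ‖u z‖ ^ 4 * ‖u z‖ ^ 2 := by ring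
      _ ≤ (4 * b z.1) * (2 * a z.2) :=
        mul_le_mul (hb z) (ha z) (by positivity) ((by positivity : (0:ℝ) ≤ _).trans (hb z))
      _ = 8 * (b z.1 * a z.2) := by ring
  have hA2 : (∫ y, a y) ^ 2 ≤ (∫ z, ‖u z‖ ^ 2) * ∫ z, ‖ux z‖ ^ 2 := by
    simp only [hA, pow_one]
    exact sq_integral_mul_le (integrable_norm_pow_succ u 1) (integrable_norm_pow_succ _ 1)
      (by simpa using hAint)
  have hB2 : (∫ x, b x) ^ 2 ≤ (∫ z, ‖u z‖ ^ 6) * ∫ z, ‖uy z‖ ^ 2 := by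
    rw [hB]
    have h6 := integrable_norm_pow_succ (μ := volume) u 5
    have hpow (z : ℝ × ℝ) : ‖u z‖ ^ 6 = (‖u z‖ ^ 3) ^ 2 := by ring
    simp only [Nat.reduceAdd, hpow] at h6 ⊢
    exact sq_integral_mul_le h6 (integrable_norm_pow_succ uy 1) hBint
  have hP : 0 ≤ ∫ z, ‖u z‖ ^ 6 := integral_nonneg fun z => by positivity
  have hM : 0 ≤ ∫ z, ‖u z‖ ^ 2 := integral_nonneg fun z => by positivity
  have hX : 0 ≤ ∫ z, ‖ux z‖ ^ 2 := integral_nonneg fun z => by positivity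
  have hZ : 0 ≤ ∫ z, ‖uy z‖ ^ 2 := integral_nonneg fun z => by positivity
  generalize (∫ z, ‖u z‖ ^ 6) = P at *
  generalize (∫ z, ‖u z‖ ^ 2) = M at *
  generalize (∫ z, ‖ux z‖ ^ 2) = X at *
  generalize (∫ z, ‖uy z‖ ^ 2) = Z at *
  generalize (∫ y, a y) = A at *
  generalize (∫ x, b x) = B at *
  rcases hP.eq_or_lt with h | h
  · rw [← h]; positivity
  · refine le_of_mul_le_mul_left ?_ h
    calc P * P = P ^ 2 := by ring
      _ ≤ (8 * (B * A)) ^ 2 := pow_le_pow_left₀ hP hprod 2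
      _ = 64 * (B ^ 2 * A ^ 2) := by ring
      _ ≤ 64 * ((P * Z) * (M * X)) := by gcongr
      _ = _ := by ring

/-- Splitting a power at height `l` between the second and the sixth power. -/
theorem rpow_le_rpow_mul_sq_add_rpow_mul_pow_six {p l s : ℝ} (hp1 : 2 < p) (hp2 : p < 6)
    (hl : 0 < l) (hs : 0 ≤ s) : s ^ p ≤ l ^ (p - 2) * s ^ 2 + l ^ (p - 6) * s ^ 6 := by
  rcases hs.eq_or_lt with rfl | hs
  · rw [Real.zero_rpow (by linarith)]; positivity
  rcases le_total s l with h | h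
  · calc s ^ p = s ^ (p - 2) * s ^ 2 := by
          rw [← Real.rpow_natCast, ← Real.rpow_add hs]; norm_num
      _ ≤ l ^ (p - 2) * s ^ 2 := by gcongr
      _ ≤ _ := le_add_of_nonneg_right (by positivity)
  · calc s ^ p = s ^ (p - 6) * s ^ 6 := by
          rw [← Real.rpow_natCast, ← Real.rpow_add hs]; norm_num
      _ ≤ l ^ (p - 6) * s ^ 6 := by
          gcongr ?_ * _
          exact Real.rpow_le_rpow_of_nonpos hl h (by linarith)
      _ ≤ _ := le_add_of_nonneg_left (by positivity)

/-- Sublinear powers are dominated by a small linear term plus a constant. -/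
theorem exists_mul_rpow_le_mul_add {r : ℝ} (hr0 : 0 ≤ r) (hr : r < 1) (A : ℝ) (hA : 0 ≤ A)
    {δ : ℝ} (hδ : 0 < δ) : ∃ B : ℝ, ∀ T : ℝ, 0 ≤ T → A * T ^ r ≤ δ * T + B := by
  have h : Tendsto (fun T : ℝ => A * T ^ (-(1 - r))) atTop (𝓝 0) := by
    simpa using (tendsto_rpow_neg_atTop (sub_pos.2 hr)).const_mul A
  obtain ⟨T₀, hT₀⟩ := eventually_atTop.1 ((h.eventually_le_const hδ).and (eventually_gt_atTop 0))
  refine ⟨A * max T₀ 0 ^ r, fun T hT => ?_⟩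
  rcases le_total T₀ T with hle | hle
  · obtain ⟨hδT, hTpos⟩ := hT₀ T hle
    calc A * T ^ r = A * T ^ (-(1 - r)) * T := by
          rw [mul_assoc, ← Real.rpow_add_one hTpos.ne']
          ring_nf
      _ ≤ δ * T := by gcongr
      _ ≤ _ := le_add_of_nonneg_right (by positivity)
  · have : A * T ^ r ≤ A * max T₀ 0 ^ r := by
      gcongr
      exact hle.trans (le_max_left _ _)
    nlinarith

theorem Pf_le_rpow {p c : ℝ} (hp1 : 2 < p) (hp2 : p < 6) (hc : 0 < c) (u : 𝓢(ℝ × ℝ, ℂ))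
    (hu : Mf u = c) :
    Pf p u ≤ (c + 64 * (c * √c)) * (Xf u + Yf u + 1) ^ (3 / 8 * (p - 2)) := by
  have hX : 0 ≤ Xf u := integral_nonneg fun z => by positivity
  have hY : 0 ≤ Yf u := integral_nonneg fun z => by positivity
  set T := Xf u + Yf u + 1 with hT
  have hT0 : 0 < T := by positivity
  have hZ : ∫ z, ‖pdy u z‖ ^ 2 ≤ √c * T ^ (1 / 2 : ℝ) := by
    rw [← Real.sqrt_eq_rpow, ← Real.sqrt_mul hc.le]
    refine Real.le_sqrt_of_sq_le ((sq_integral_norm_pdy_sq_le u).trans ?_)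
    rw [hu]
    gcongr
    linarith
  have hsix : ∫ z, ‖u z‖ ^ 6 ≤ 64 * (c * √c) * T ^ (3 / 2 : ℝ) := by
    calc _ ≤ 64 * c * Xf u * ∫ z, ‖pdy u z‖ ^ 2 := hu ▸ integral_norm_pow_six_le u
      _ ≤ 64 * c * T * (√c * T ^ (1 / 2 : ℝ)) := by gcongr; linarith
      _ = 64 * (c * √c) * (T ^ (1 : ℝ) * T ^ (1 / 2 : ℝ)) := by rw [Real.rpow_one]; ring
      _ = _ := by rw [← Real.rpow_add hT0]; norm_num
  set l : ℝ := T ^ (3 / 8 : ℝ) with hl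
  have hl0 : 0 < l := by positivity
  have h2 := (integrable_norm_pow_succ (μ := volume) u 1).const_mul (l ^ (p - 2))
  have h6 := (integrable_norm_pow_succ (μ := volume) u 5).const_mul (l ^ (p - 6))
  calc Pf p u ≤ ∫ z, (l ^ (p - 2) * ‖u z‖ ^ 2 + l ^ (p - 6) * ‖u z‖ ^ 6) :=
        integral_mono_of_nonneg (ae_of_all _ fun z => by positivity) (h2.add h6)
          (ae_of_all _ fun z =>
            rpow_le_rpow_mul_sq_add_rpow_mul_pow_six hp1 hp2 hl0 (norm_nonneg _))
    _ = l ^ (p - 2) * c + l ^ (p - 6) * ∫ z, ‖u z‖ ^ 6 := by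
        rw [integral_add h2 h6, integral_const_mul, integral_const_mul, ← hu, Mf]
    _ ≤ l ^ (p - 2) * c + l ^ (p - 6) * (64 * (c * √c) * T ^ (3 / 2 : ℝ)) := by gcongr
    _ = T ^ (3 / 8 * (p - 2)) * c
        + 64 * (c * √c) * (T ^ (3 / 8 * (p - 6)) * T ^ (3 / 2 : ℝ)) := by
        rw [hl, ← Real.rpow_mul hT0.le, ← Real.rpow_mul hT0.le]; ring
    _ = _ := by
        rw [← Real.rpow_add hT0, show 3 / 8 * (p - 6) + 3 / 2 = 3 / 8 * (p - 2) by ring]; ring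

/-- The constrained energy infimum m(c) is finite in the mass-subcritical regime. -/
theorem stmt_12 (p : ℝ) (hp1 : 2 < p) (hp2 : p < 14 / 3) (c : ℝ) (hc : 0 < c) :
    ∃ B : ℝ, ∀ u : SchwartzMap (ℝ × ℝ) ℂ, Mf (fun z => u z) = c → B ≤ Ef p (fun z => u z) := by
  obtain ⟨B, hB⟩ := exists_mul_rpow_le_mul_add (r := 3 / 8 * (p - 2)) (by linarith) (by linarith)
    (c + 64 * (c * √c)) (by positivity) (half_pos (by linarith : 0 < p))
  refine ⟨-1 / 2 - B / p, fun u hu => ?_⟩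
  have hX : 0 ≤ Xf u := integral_nonneg fun z => by positivity
  have hY : 0 ≤ Yf u := integral_nonneg fun z => by positivity
  have h := (Pf_le_rpow hp1 (by linarith) hc u hu).trans (hB (Xf u + Yf u + 1) (by positivity))
  have hp : Pf p u / p ≤ (Xf u + Yf u + 1) / 2 + B / p := by
    rw [div_le_iff₀ (by linarith)]
    convert h using 1
    field_simp
  change _ ≤ Xf u / 2 + Yf u / 2 - Pf p u / p
  linarith
end

section
/- Let p > 2 and ω > 0. There exists δ > 0 such that every Schwartz function u : ℝ² → ℂ, not identically zero, that satisfies the Nehari constraint X(u) + Y(u) + ω·M(u) = P(u) has J_ω(u) ≥ δ; in other words, the Nehari ground-state level m_ω is strictly positive. -/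
open MeasureTheory

open Real SchwartzMap FourierTransform LineDeriv

/-- The anisotropic weight `1 + ξ² + η⁴` has integrable reciprocal on the plane. -/
theorem integrable_inv_one_add_sq_add_pow_four :
    Integrable (fun z : ℝ × ℝ => (1 + z.1 ^ 2 + z.2 ^ 4)⁻¹) := by
  have h1 : Integrable (fun x : ℝ => (1 + ‖x‖ ^ 2) ^ (-(4 / 3 : ℝ) / 2)) :=
    integrable_rpow_neg_one_add_norm_sq (by norm_num)
  refine ((h1.mul_prod h1).const_mul 2).mono' (by fun_prop) (ae_of_all _ fun z => ?_)
  obtain ⟨x, y⟩ := z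
  have hw : 0 < 1 + x ^ 2 + y ^ 4 := by positivity
  have ha : 0 < 1 + x ^ 2 := by positivity
  have hb : 0 < 1 + y ^ 2 := by positivity
  have hexp : -(4 / 3 : ℝ) / 2 = -(2 / 3) := by norm_num
  have hyoung : (1 + x ^ 2) ^ (2 / 3 : ℝ) * (1 + y ^ 2) ^ (2 / 3 : ℝ) ≤
      2 * (1 + x ^ 2 + y ^ 4) := by
    have h := Real.geom_mean_le_arith_mean2_weighted (w₁ := 2 / 3) (w₂ := 1 / 3)
      (by norm_num) (by norm_num) ha.le (sq_nonneg (1 + y ^ 2)) (by norm_num)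
    rw [← Real.rpow_natCast (1 + y ^ 2) 2, ← Real.rpow_mul hb.le] at h
    norm_num at h
    nlinarith [sq_nonneg (y ^ 2 - 1), sq_nonneg x, sq_nonneg (y ^ 2)]
  simp only [Real.norm_eq_abs, sq_abs, hexp]
  rw [abs_of_pos (inv_pos.2 hw), Real.rpow_neg ha.le, Real.rpow_neg hb.le, ← mul_inv,
    inv_le_iff_one_le_mul₀ hw]
  have hprod : 0 < (1 + x ^ 2) ^ (2 / 3 : ℝ) * (1 + y ^ 2) ^ (2 / 3 : ℝ) := by positivity
  calc (1 : ℝ) = ((1 + x ^ 2) ^ (2 / 3 : ℝ) * (1 + y ^ 2) ^ (2 / 3 : ℝ))⁻¹ *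
        ((1 + x ^ 2) ^ (2 / 3 : ℝ) * (1 + y ^ 2) ^ (2 / 3 : ℝ)) := (inv_mul_cancel₀ hprod.ne').symm
    _ ≤ ((1 + x ^ 2) ^ (2 / 3 : ℝ) * (1 + y ^ 2) ^ (2 / 3 : ℝ))⁻¹ * (2 * (1 + x ^ 2 + y ^ 4)) := by
        gcongr
    _ = _ := by ring

theorem norm_fourier_lineDerivOp {V : Type*} [NormedAddCommGroup V] [InnerProductSpace ℝ V]
    [FiniteDimensional ℝ V] [MeasurableSpace V] [BorelSpace V] (f : 𝓢(V, ℂ)) (m ξ : V) :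
    ‖𝓕 (∂_{m} f) ξ‖ = 2 * π * |inner ℝ ξ m| * ‖𝓕 f ξ‖ := by
  have : (inner ℝ · m : V → ℝ).HasTemperateGrowth := ((innerSL ℝ).flip m).hasTemperateGrowth
  rw [fourier_lineDerivOp_eq]
  simp [this, abs_of_pos Real.pi_pos, mul_assoc]

theorem integrable_norm_sq_schwartz {V : Type*} [NormedAddCommGroup V] [NormedSpace ℝ V]
    [MeasureSpace V] [BorelSpace V] [SecondCountableTopology V]
    [(volume : Measure V).HasTemperateGrowth] (f : 𝓢(V, ℂ)) :
    Integrable (fun z => ‖f z‖ ^ 2) :=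
  (memLp_two_iff_integrable_sq_norm f.continuous.aestronglyMeasurable).1 (f.memLp 2)

/-- Anisotropic Sobolev embedding into `L^∞`, in a form linear in the squared norm. -/
theorem norm_le_of_anisotropic (f : 𝓢(WithLp 2 (ℝ × ℝ), ℂ)) (x : WithLp 2 (ℝ × ℝ))
    {t : ℝ} (ht : 0 < t) :
    ‖f x‖ ≤ t * (∫ z : ℝ × ℝ, (1 + z.1 ^ 2 + z.2 ^ 4)⁻¹) +
      t⁻¹ * ((∫ z, ‖f z‖ ^ 2) + (∫ z, ‖∂_{WithLp.toLp 2 ((1 : ℝ), (0 : ℝ))} f z‖ ^ 2) +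
        ∫ z, ‖∂_{WithLp.toLp 2 ((0 : ℝ), (1 : ℝ))}
          (∂_{WithLp.toLp 2 ((0 : ℝ), (1 : ℝ))} f) z‖ ^ 2) := by
  set e₁ : WithLp 2 (ℝ × ℝ) := WithLp.toLp 2 ((1 : ℝ), (0 : ℝ))
  set e₂ : WithLp 2 (ℝ × ℝ) := WithLp.toLp 2 ((0 : ℝ), (1 : ℝ))
  have hmp : MeasurePreserving (@WithLp.ofLp 2 (ℝ × ℝ)) := WithLp.volume_preserving_ofLp ℝ ℝ
  have hemb : MeasurableEmbedding (@WithLp.ofLp 2 (ℝ × ℝ)) :=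
    (MeasurableEquiv.toLp 2 (ℝ × ℝ)).symm.measurableEmbedding
  have hwint : Integrable (fun ξ : WithLp 2 (ℝ × ℝ) => (1 + ξ.fst ^ 2 + ξ.snd ^ 4)⁻¹) :=
    hmp.integrable_comp_of_integrable integrable_inv_one_add_sq_add_pow_four
  have hwval : ∫ ξ : WithLp 2 (ℝ × ℝ), (1 + ξ.fst ^ 2 + ξ.snd ^ 4)⁻¹ =
      ∫ z : ℝ × ℝ, (1 + z.1 ^ 2 + z.2 ^ 4)⁻¹ :=
    hmp.integral_comp hemb (fun z : ℝ × ℝ => (1 + z.1 ^ 2 + z.2 ^ 4)⁻¹)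
  have hi0 := integrable_norm_sq_schwartz (𝓕 f)
  have hi1 := integrable_norm_sq_schwartz (𝓕 (∂_{e₁} f))
  have hi01 : Integrable (fun z => ‖𝓕 f z‖ ^ 2 + ‖𝓕 (∂_{e₁} f) z‖ ^ 2) := hi0.add hi1
  have hi2 := integrable_norm_sq_schwartz (𝓕 (∂_{e₂} (∂_{e₂} f)))
  have hi012 : Integrable (fun z => ‖𝓕 f z‖ ^ 2 + ‖𝓕 (∂_{e₁} f) z‖ ^ 2 +
      ‖𝓕 (∂_{e₂} (∂_{e₂} f)) z‖ ^ 2) := hi01.add hi2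
  rw [← hwval, ← integral_norm_sq_fourier f, ← integral_norm_sq_fourier (∂_{e₁} f),
    ← integral_norm_sq_fourier (∂_{e₂} (∂_{e₂} f)), ← integral_add hi0 hi1,
    ← integral_add hi01 hi2, ← integral_const_mul, ← integral_const_mul,
    ← integral_add (hwint.const_mul t) (hi012.const_mul t⁻¹)]
  have hinv : f x = ∫ ξ, 𝐞 (inner ℝ ξ x) • 𝓕 f ξ := by
    conv_lhs => rw [← FourierTransform.fourierInv_fourier_eq (F := 𝓢(WithLp 2 (ℝ × ℝ), ℂ)) f]
    rw [fourierInv_coe, Real.fourierInv_eq]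
  rw [hinv]
  refine (norm_integral_le_integral_norm _).trans (integral_mono_of_nonneg
    (ae_of_all _ fun _ => norm_nonneg _)
    ((hwint.const_mul t).add (hi012.const_mul t⁻¹)) (ae_of_all _ fun ξ => ?_))
  have hw : 0 < 1 + ξ.fst ^ 2 + ξ.snd ^ 4 := by positivity
  have hpi : (1 : ℝ) ≤ 2 * π := by linarith [Real.pi_gt_three]
  have h₁ : |inner ℝ ξ e₁| = |ξ.fst| := by simp [e₁, WithLp.prod_inner_apply]
  have h₂ : |inner ℝ ξ e₂| = |ξ.snd| := by simp [e₂, WithLp.prod_inner_apply]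
  simp only [Circle.norm_smul, norm_fourier_lineDerivOp, h₁, h₂]
  set a := ‖𝓕 f ξ‖
  have hlower : (1 + ξ.fst ^ 2 + ξ.snd ^ 4) * a ^ 2 ≤ a ^ 2 + (2 * π * |ξ.fst| * a) ^ 2 +
      (2 * π * |ξ.snd| * (2 * π * |ξ.snd| * a)) ^ 2 := by
    have e1 : (2 * π * |ξ.fst| * a) ^ 2 = (2 * π) ^ 2 * (ξ.fst ^ 2 * a ^ 2) := by
      simp only [mul_pow, sq_abs]; ring
    have e2 : (2 * π * |ξ.snd| * (2 * π * |ξ.snd| * a)) ^ 2 =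
        (2 * π) ^ 4 * (ξ.snd ^ 4 * a ^ 2) := by
      simp only [mul_pow, sq_abs]; ring
    have g1 : ξ.fst ^ 2 * a ^ 2 ≤ (2 * π) ^ 2 * (ξ.fst ^ 2 * a ^ 2) :=
      le_mul_of_one_le_left (by positivity) (one_le_pow₀ hpi)
    have g2 : ξ.snd ^ 4 * a ^ 2 ≤ (2 * π) ^ 4 * (ξ.snd ^ 4 * a ^ 2) :=
      le_mul_of_one_le_left (by positivity) (one_le_pow₀ hpi)
    rw [e1, e2]
    linarith
  refine le_trans ?_ (add_le_add_right (mul_le_mul_of_nonneg_left hlower (inv_pos.2 ht).le) _)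
  set w := 1 + ξ.fst ^ 2 + ξ.snd ^ 4
  have ha : 0 ≤ a := norm_nonneg _
  have hq : 0 < t * w⁻¹ := by positivity
  have key : a = t * w⁻¹ * (t⁻¹ * w * a) := by field_simp
  have hsq : t⁻¹ * (w * a ^ 2) = t * w⁻¹ * (t⁻¹ * w * a) ^ 2 := by field_simp
  rw [hsq]
  nth_rewrite 1 [key]
  nlinarith [sq_nonneg (t⁻¹ * w * a - 1), mul_nonneg hq.le (sq_nonneg (t⁻¹ * w * a - 1)),
    mul_nonneg hq.le (sq_nonneg (t⁻¹ * w * a))]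

theorem pdx_schwartz_s15 (u : 𝓢(ℝ × ℝ, ℂ)) :
    pdx (fun z => u z) = fun z => ∂_{((1 : ℝ), (0 : ℝ))} u z := by
  ext z
  have h := ((u.hasFDerivAt z).comp_hasDerivAt z.1
    ((hasDerivAt_id z.1).prodMk (hasDerivAt_const z.1 z.2))).deriv
  simpa [pdx, Function.comp_def, lineDerivOp_apply_eq_fderiv] using h

theorem pdy_schwartz_s15 (u : 𝓢(ℝ × ℝ, ℂ)) :
    pdy (fun z => u z) = fun z => ∂_{((0 : ℝ), (1 : ℝ))} u z := by
  ext z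
  have h := ((u.hasFDerivAt z).comp_hasDerivAt z.2
    ((hasDerivAt_const z.2 z.1).prodMk (hasDerivAt_id z.2))).deriv
  simpa [pdy, Function.comp_def, lineDerivOp_apply_eq_fderiv] using h

/-- The embedding `norm_le_of_anisotropic` for Schwartz functions on `ℝ × ℝ`. -/
theorem norm_le_Xf_Yf_Mf (u : 𝓢(ℝ × ℝ, ℂ)) (x : ℝ × ℝ) {t : ℝ} (ht : 0 < t) :
    ‖u x‖ ≤ t * (∫ z : ℝ × ℝ, (1 + z.1 ^ 2 + z.2 ^ 4)⁻¹) +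
      t⁻¹ * (Mf (fun z => u z) + Xf (fun z => u z) + Yf (fun z => u z)) := by
  let g : WithLp 2 (ℝ × ℝ) ≃L[ℝ] ℝ × ℝ := WithLp.prodContinuousLinearEquiv 2 ℝ ℝ ℝ
  have hmp : MeasurePreserving (@WithLp.ofLp 2 (ℝ × ℝ)) := WithLp.volume_preserving_ofLp ℝ ℝ
  have hemb : MeasurableEmbedding (@WithLp.ofLp 2 (ℝ × ℝ)) :=
    (MeasurableEquiv.toLp 2 (ℝ × ℝ)).symm.measurableEmbedding
  have h := norm_le_of_anisotropic (compCLMOfContinuousLinearEquiv ℂ g u) (WithLp.toLp 2 x) ht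
  have hint (v : 𝓢(ℝ × ℝ, ℂ)) :
      ∫ z, ‖compCLMOfContinuousLinearEquiv ℂ g v z‖ ^ 2 = ∫ z, ‖v z‖ ^ 2 :=
    hmp.integral_comp hemb (fun z => ‖v z‖ ^ 2)
  simp only [lineDerivOp_compCLMOfContinuousLinearEquiv, hint] at h
  simp only [Mf, Xf, Yf, pdyy, pdx_schwartz_s15, pdy_schwartz_s15]
  exact h

theorem Mf_pos (u : 𝓢(ℝ × ℝ, ℂ)) (hu : u ≠ 0) : 0 < Mf (fun z => u z) := by
  obtain ⟨x, hx⟩ : ∃ x, u x ≠ 0 := by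
    by_contra! h
    exact hu (SchwartzMap.ext h)
  exact integral_pos_of_integrable_nonneg_nonzero (x := x) (by fun_prop)
    (integrable_norm_sq_schwartz u)
    (fun z => by positivity) (by simpa using hx)

theorem Pf_le_of_norm_le {p S : ℝ} (hp : 2 < p) (u : 𝓢(ℝ × ℝ, ℂ)) (hS : ∀ x, ‖u x‖ ≤ S) :
    Pf p (fun z => u z) ≤ S ^ (p - 2) * Mf (fun z => u z) := by
  rw [Pf, Mf, ← integral_const_mul]
  refine integral_mono_of_nonneg (ae_of_all _ fun z => by positivity) ((integrable_norm_sq_schwartz u).const_mul _)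
    (ae_of_all _ fun z => ?_)
  calc ‖u z‖ ^ p = ‖u z‖ ^ (p - 2) * ‖u z‖ ^ 2 := by
        rw [← Real.rpow_natCast ‖u z‖ 2, ← Real.rpow_add_of_nonneg (norm_nonneg _)
          (by linarith) (by norm_num)]
        norm_num
    _ ≤ S ^ (p - 2) * ‖u z‖ ^ 2 := by
        gcongr
        exact hS z

/-- Positivity of the Nehari ground-state level. -/
theorem stmt_15 (p ω : ℝ) (hp : 2 < p) (hω : 0 < ω) :
    ∃ δ > (0 : ℝ), ∀ u : SchwartzMap (ℝ × ℝ) ℂ, u ≠ 0 →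
      Xf (fun z => u z) + Yf (fun z => u z) + ω * Mf (fun z => u z) = Pf p (fun z => u z) →
        δ ≤ Jf p ω (fun z => u z) := by
  set A := ∫ z : ℝ × ℝ, (1 + z.1 ^ 2 + z.2 ^ 4)⁻¹
  have hA : 0 ≤ A := integral_nonneg fun z => by positivity
  set K := 1 + ω⁻¹
  have hK : 0 < K := by positivity
  set c := ω ^ (p - 2)⁻¹
  have hc : 0 < c := by positivity
  have hcoef : 0 < 1 / 2 - 1 / p := by
    rw [sub_pos]; exact one_div_lt_one_div_of_lt (by norm_num) hp
  refine ⟨(1 / 2 - 1 / p) * ((c / (A + 1)) ^ 2 / K), by positivity, fun u hu hN => ?_⟩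
  have hM := Mf_pos u hu
  have hX : 0 ≤ Xf (fun z => u z) := integral_nonneg fun z => by positivity
  have hY : 0 ≤ Yf (fun z => u z) := integral_nonneg fun z => by positivity
  have hbound := fun x => norm_le_Xf_Yf_Mf u x (t := √(K * Pf p (fun z => u z)))
  have hP := fun S => Pf_le_of_norm_le (S := S) hp u
  have hJ : Jf p ω (fun z => u z) = (1 / 2 - 1 / p) * Pf p (fun z => u z) := by
    rw [Jf, ← hN]; ring
  rw [hJ]
  set X := Xf (fun z => u z)
  set Y := Yf (fun z => u z)
  set M := Mf (fun z => u z)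
  set N := Pf p (fun z => u z)
  have hNpos : 0 < N := by rw [← hN]; positivity
  have hKN : 0 < K * N := by positivity
  have hs : 0 < √(K * N) := Real.sqrt_pos.2 hKN
  have hMN : ω * M ≤ N := by linarith
  have hsum : M + X + Y ≤ K * N := by
    have : M ≤ ω⁻¹ * N := by rwa [inv_mul_eq_div, le_div_iff₀' hω]
    have hωM : 0 ≤ ω * M := by positivity
    simp only [K, add_mul, one_mul]
    linarith
  have hsup : ∀ x, ‖u x‖ ≤ √(K * N) * (A + 1) := fun x => by
    refine (hbound x hs).trans ?_
    have : (√(K * N))⁻¹ * (M + X + Y) ≤ √(K * N) := by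
      rw [inv_mul_le_iff₀ hs, Real.mul_self_sqrt hKN.le]
      exact hsum
    linarith
  have hpow : ω ≤ (√(K * N) * (A + 1)) ^ (p - 2) := by
    refine le_of_mul_le_mul_right ?_ hM
    exact hMN.trans (hP _ hsup)
  have hcle : c ≤ √(K * N) * (A + 1) :=
    (Real.rpow_inv_le_iff_of_pos hω.le (by positivity) (by linarith)).2 hpow
  refine mul_le_mul_of_nonneg_left ?_ hcoef.le
  rw [div_le_iff₀ hK, mul_comm N K, ← Real.le_sqrt (by positivity) hKN.le,
    div_le_iff₀ (by positivity)]
  exact hcle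
end

section
/- For every real q with 1 ≤ q < ∞, the fundamental solution K belongs to L^q(ℝ²), i.e. ∫_{ℝ²} |K(x,y)|^q dxdy < ∞. -/
open MeasureTheory

noncomputable section

/-- H(x,y,t) = ∫_{ℝ²} e^{−2πi(xξ₁+yξ₂)} e^{−t(ξ₁²+ξ₂⁴)} dξ. -/
def Hker (x y t : ℝ) : ℂ :=
  ∫ ξ : ℝ × ℝ,
    Complex.exp (-2 * Real.pi * Complex.I * ((x : ℂ) * (ξ.1 : ℂ) + (y : ℂ) * (ξ.2 : ℂ)))
      * Complex.exp (-(t : ℂ) * ((ξ.1 : ℂ) ^ 2 + (ξ.2 : ℂ) ^ 4))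

/-- Fundamental solution K(x,y) = ∫₀^∞ e^{−t} H(x,y,t) dt of −∂ₓₓ + ∂_yyyy + 1. -/
def Kker (x y : ℝ) : ℂ :=
  ∫ t in Set.Ioi (0 : ℝ), Real.exp (-t) • Hker x y t

end

open scoped FourierTransform

/-- The Fourier transform of an integrable function with two integrable derivatives
decays quadratically. -/
lemma exists_norm_fourier_le_inv_one_add_sq {f f' f'' : ℝ → ℂ}
    (hf : ∀ x, HasDerivAt f (f' x) x) (hf' : ∀ x, HasDerivAt f' (f'' x) x)
    (hi : Integrable f) (hi' : Integrable f') (hi'' : Integrable f'') :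
    ∃ C : ℝ, 0 ≤ C ∧ ∀ y : ℝ, ‖𝓕 f y‖ ≤ C * (1 + y ^ 2)⁻¹ := by
  have hd : deriv f = f' := funext fun x => (hf x).deriv
  have hd' : deriv f' = f'' := funext fun x => (hf' x).deriv
  have bound (g : ℝ → ℂ) (y : ℝ) : ‖𝓕 g y‖ ≤ ∫ x, ‖g x‖ :=
    VectorFourier.norm_fourierIntegral_le_integral_norm _ _ _ _ _
  have h₁ := Real.fourier_deriv hi (fun x => (hf x).differentiableAt) (hd ▸ hi')
  have h₂ := Real.fourier_deriv hi' (fun x => (hf' x).differentiableAt) (hd' ▸ hi'')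
  rw [hd] at h₁
  rw [hd', h₁] at h₂
  refine ⟨(∫ x, ‖f x‖) + ∫ x, ‖f'' x‖, by positivity, fun y => ?_⟩
  rw [← div_eq_mul_inv, le_div_iff₀ (by positivity)]
  have b₂ := bound f'' y
  rw [h₂] at b₂
  simp only [smul_eq_mul, norm_mul, Complex.norm_real, Complex.norm_I, Complex.norm_ofNat,
    Real.norm_eq_abs, abs_of_pos Real.pi_pos, mul_one] at b₂
  have hpi : 1 ≤ 2 * Real.pi := by linarith [Real.pi_gt_three]
  have key : y ^ 2 * ‖𝓕 f y‖ ≤ 2 * Real.pi * |y| * (2 * Real.pi * |y| * ‖𝓕 f y‖) := by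
    have : 0 ≤ y ^ 2 * ‖𝓕 f y‖ := by positivity
    calc y ^ 2 * ‖𝓕 f y‖ ≤ (2 * Real.pi) ^ 2 * (y ^ 2 * ‖𝓕 f y‖) :=
          le_mul_of_one_le_left this (one_le_pow₀ hpi)
      _ = _ := by rw [← sq_abs y]; ring
  linarith [bound f y]

lemma integrable_pow_mul_cexp_neg_pow (k m : ℕ) :
    Integrable fun x : ℝ => (x : ℂ) ^ k * Complex.exp (-(x : ℂ) ^ (2 * m + 2)) := by
  have h : Integrable fun x : ℝ => x ^ k * Real.exp (-1 * x ^ 2) := by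
    simpa using integrable_rpow_mul_exp_neg_mul_sq one_pos
      (s := k) (by linarith [Nat.cast_nonneg (α := ℝ) k])
  refine (h.const_mul (Real.exp 1)).mono (by fun_prop) (.of_forall fun x => ?_)
  have hx : x ^ 2 ≤ x ^ (2 * m + 2) + 1 := by
    rw [show 2 * m + 2 = 2 * (m + 1) by ring, pow_mul]
    rcases le_total (x ^ 2) 1 with h1 | h1
    · linarith [show 0 ≤ (x ^ 2) ^ (m + 1) by positivity]
    · exact (le_self_pow₀ h1 m.succ_ne_zero).trans (by simp)
  have he : Complex.exp (-(x : ℂ) ^ (2 * m + 2)) = (Real.exp (-x ^ (2 * m + 2)) : ℝ) := by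
    push_cast; rfl
  rw [he]
  simp only [norm_mul, norm_pow, Complex.norm_real, Real.norm_eq_abs, Real.abs_exp]
  rw [mul_left_comm, ← Real.exp_add]
  gcongr
  linarith

lemma exists_norm_fourier_cexp_neg_pow_le (m : ℕ) : ∃ C : ℝ, 0 ≤ C ∧ ∀ y : ℝ,
    ‖𝓕 (fun x : ℝ => Complex.exp (-(x : ℂ) ^ (2 * m + 2))) y‖ ≤ C * (1 + y ^ 2)⁻¹ := by
  set n : ℂ := 2 * m + 2 with hn
  have he (z : ℂ) : HasDerivAt (fun z : ℂ => Complex.exp (-z ^ (2 * m + 2)))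
      (-(n * (z ^ (2 * m + 1) * Complex.exp (-z ^ (2 * m + 2))))) z := by
    refine ((hasDerivAt_pow (2 * m + 2) z).fun_neg.cexp).congr_deriv ?_
    rw [show 2 * m + 2 - 1 = 2 * m + 1 by omega, hn]
    push_cast
    ring
  have he' (z : ℂ) : HasDerivAt
      (fun z : ℂ => -(n * (z ^ (2 * m + 1) * Complex.exp (-z ^ (2 * m + 2)))))
      (n ^ 2 * (z ^ (4 * m + 2) * Complex.exp (-z ^ (2 * m + 2))) -
        n * (2 * m + 1) * (z ^ (2 * m) * Complex.exp (-z ^ (2 * m + 2)))) z := by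
    refine (((hasDerivAt_pow (2 * m + 1) z).fun_mul (he z)).const_mul n).fun_neg.congr_deriv ?_
    rw [Nat.add_sub_cancel]
    push_cast
    ring
  refine exists_norm_fourier_le_inv_one_add_sq (fun x => (he x).comp_ofReal)
    (fun x => (he' x).comp_ofReal) ?_ ?_ ?_
  · simpa using integrable_pow_mul_cexp_neg_pow 0 m
  · exact ((integrable_pow_mul_cexp_neg_pow _ m).const_mul n).neg
  · exact ((integrable_pow_mul_cexp_neg_pow _ m).const_mul _).sub
      ((integrable_pow_mul_cexp_neg_pow _ m).const_mul _)

lemma exists_norm_integral_cexp_scaled_le (m : ℕ) : ∃ C : ℝ, 0 ≤ C ∧ ∀ s : ℝ, 0 < s → ∀ y : ℝ,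
    ‖∫ ξ : ℝ, Complex.exp (-2 * Real.pi * Complex.I * (y * ξ))
        * Complex.exp (-(s : ℂ) ^ (2 * m + 2) * (ξ : ℂ) ^ (2 * m + 2))‖
      ≤ s⁻¹ * (C * (1 + (s⁻¹ * y) ^ 2)⁻¹) := by
  obtain ⟨C, hC, h⟩ := exists_norm_fourier_cexp_neg_pow_le m
  refine ⟨C, hC, fun s hs y => ?_⟩
  have hs' : (s : ℂ) ≠ 0 := by exact_mod_cast hs.ne'
  have := Measure.integral_comp_mul_left (fun v : ℝ =>
    Complex.exp (↑(-2 * Real.pi * v * (s⁻¹ * y)) * Complex.I) •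
      Complex.exp (-(v : ℂ) ^ (2 * m + 2))) s
  rw [← Real.fourier_real_eq_integral_exp_smul
    (fun x : ℝ => Complex.exp (-(x : ℂ) ^ (2 * m + 2)))] at this
  have h2 : (∫ ξ : ℝ, Complex.exp (-2 * Real.pi * Complex.I * (y * ξ))
        * Complex.exp (-(s : ℂ) ^ (2 * m + 2) * (ξ : ℂ) ^ (2 * m + 2))) =
      |s⁻¹| • 𝓕 (fun x : ℝ => Complex.exp (-(x : ℂ) ^ (2 * m + 2))) (s⁻¹ * y) := by
    rw [← this]
    congr 1 with ξ
    rw [smul_eq_mul]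
    congr 2
    · push_cast
      field_simp
    · push_cast
      rw [mul_pow, neg_mul]
  rw [h2, norm_smul, Real.norm_eq_abs, abs_abs, abs_of_pos (inv_pos.2 hs)]
  gcongr
  exact h _

lemma lintegral_inv_one_add_sq_scaled {s C : ℝ} (hs : 0 < s) (hC : 0 ≤ C) :
    ∫⁻ y : ℝ, ENNReal.ofReal (s⁻¹ * (C * (1 + (s⁻¹ * y) ^ 2)⁻¹))
      = ENNReal.ofReal (C * Real.pi) := by
  have hi : Integrable fun y : ℝ => (1 + (s⁻¹ * y) ^ 2)⁻¹ :=
    integrable_inv_one_add_sq.comp_mul_left' (inv_ne_zero hs.ne')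
  rw [← ofReal_integral_eq_lintegral_ofReal ((hi.const_mul _).const_mul _)
    (.of_forall fun y => by positivity), integral_const_mul, integral_const_mul,
    Measure.integral_comp_mul_left (fun y : ℝ => (1 + y ^ 2)⁻¹), integral_univ_inv_one_add_sq,
    inv_inv, abs_of_pos hs, smul_eq_mul]
  congr 1
  field_simp

lemma Hker_eq_mul (x y t : ℝ) : Hker x y t =
    (∫ ξ : ℝ, Complex.exp (-2 * Real.pi * Complex.I * (x * ξ))
        * Complex.exp (-(t : ℂ) * (ξ : ℂ) ^ 2)) *
    ∫ ξ : ℝ, Complex.exp (-2 * Real.pi * Complex.I * (y * ξ))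
        * Complex.exp (-(t : ℂ) * (ξ : ℂ) ^ 4) := by
  rw [Hker, ← integral_prod_mul, ← Measure.volume_eq_prod]
  congr 1 with ξ
  simp only [mul_add, Complex.exp_add]
  ring

/-- The heat kernel is dominated by a product of rescaled Cauchy profiles. -/
lemma exists_norm_Hker_le : ∃ A B : ℝ, 0 ≤ A ∧ 0 ≤ B ∧ ∀ t : ℝ, 0 < t → ∀ x y : ℝ,
    ‖Hker x y t‖ ≤
      ((t ^ (1 / 2 : ℝ))⁻¹ * (A * (1 + ((t ^ (1 / 2 : ℝ))⁻¹ * x) ^ 2)⁻¹)) *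
      ((t ^ (1 / 4 : ℝ))⁻¹ * (B * (1 + ((t ^ (1 / 4 : ℝ))⁻¹ * y) ^ 2)⁻¹)) := by
  obtain ⟨A, hA, hA'⟩ := exists_norm_integral_cexp_scaled_le 0
  obtain ⟨B, hB, hB'⟩ := exists_norm_integral_cexp_scaled_le 1
  refine ⟨A, B, hA, hB, fun t ht x y => ?_⟩
  have h2 : ((t ^ (1 / 2 : ℝ) : ℝ) : ℂ) ^ (2 * 0 + 2) = t := by
    rw [← Complex.ofReal_pow, ← Real.rpow_natCast, ← Real.rpow_mul ht.le]
    norm_num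
  have h4 : ((t ^ (1 / 4 : ℝ) : ℝ) : ℂ) ^ (2 * 1 + 2) = t := by
    rw [← Complex.ofReal_pow, ← Real.rpow_natCast, ← Real.rpow_mul ht.le]
    norm_num
  have hx := hA' (t ^ (1 / 2 : ℝ)) (by positivity) x
  have hy := hB' (t ^ (1 / 4 : ℝ)) (by positivity) y
  rw [h2] at hx
  rw [h4] at hy
  rw [Hker_eq_mul, norm_mul]
  exact mul_le_mul hx hy (norm_nonneg _) ((norm_nonneg _).trans hx)

lemma exists_enorm_Kker_le : ∃ M : ENNReal, M ≠ ⊤ ∧ ∀ x y : ℝ, ‖Kker x y‖ₑ ≤ M := by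
  obtain ⟨A, B, hA, hB, h⟩ := exists_norm_Hker_le
  have hi := (Real.GammaIntegral_convergent (s := 1 / 4) (by norm_num)).const_mul (A * B)
  refine ⟨_, hi.lintegral_lt_top.ne, fun x y => ?_⟩
  refine (enorm_integral_le_lintegral_enorm _).trans
    (setLIntegral_mono' measurableSet_Ioi fun t ht => ?_)
  rw [Set.mem_Ioi] at ht
  rw [← ofReal_norm]
  refine ENNReal.ofReal_le_ofReal ?_
  rw [norm_smul, Real.norm_eq_abs, Real.abs_exp, mul_left_comm]
  gcongr
  have hp : (t : ℝ) ^ (1 / 4 - 1 : ℝ) = (t ^ (1 / 2 : ℝ))⁻¹ * (t ^ (1 / 4 : ℝ))⁻¹ := by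
    rw [← Real.rpow_neg ht.le, ← Real.rpow_neg ht.le, ← Real.rpow_add ht]
    norm_num
  have hle (u : ℝ) : (1 + u ^ 2)⁻¹ ≤ 1 := inv_le_one_of_one_le₀ (by linarith [sq_nonneg u])
  calc ‖Hker x y t‖ ≤ _ := h t ht x y
    _ ≤ ((t ^ (1 / 2 : ℝ))⁻¹ * (A * 1)) * ((t ^ (1 / 4 : ℝ))⁻¹ * (B * 1)) := by
      gcongr <;> exact hle _
    _ = A * B * t ^ (1 / 4 - 1 : ℝ) := by rw [hp]; ring

lemma lintegral_enorm_Kker_lt_top : ∫⁻ z : ℝ × ℝ, ‖Kker z.1 z.2‖ₑ < ⊤ := by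
  obtain ⟨A, B, hA, hB, h⟩ := exists_norm_Hker_le
  let P (C p t y : ℝ) : ENNReal :=
    ENNReal.ofReal ((t ^ p)⁻¹ * (C * (1 + ((t ^ p)⁻¹ * y) ^ 2)⁻¹))
  have hK (z : ℝ × ℝ) : ‖Kker z.1 z.2‖ₑ ≤ ∫⁻ t in Set.Ioi (0 : ℝ),
      ENNReal.ofReal (Real.exp (-t)) * (P A (1 / 2) t z.1 * P B (1 / 4) t z.2) := by
    refine (enorm_integral_le_lintegral_enorm _).trans
      (setLIntegral_mono' measurableSet_Ioi fun t ht => ?_)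
    rw [Set.mem_Ioi] at ht
    rw [← ofReal_norm, norm_smul, Real.norm_eq_abs, Real.abs_exp,
      ENNReal.ofReal_mul (Real.exp_pos _).le]
    exact mul_le_mul_right
      ((ENNReal.ofReal_le_ofReal (h t ht _ _)).trans_eq (ENNReal.ofReal_mul (by positivity))) _
  refine (lintegral_mono hK).trans_lt ?_
  rw [lintegral_lintegral_swap (by unfold Function.uncurry; fun_prop)]
  have hint : ∀ t ∈ Set.Ioi (0 : ℝ), ∫⁻ z : ℝ × ℝ,
      ENNReal.ofReal (Real.exp (-t)) * (P A (1 / 2) t z.1 * P B (1 / 4) t z.2) =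
      ENNReal.ofReal (Real.exp (-t)) *
        (ENNReal.ofReal (A * Real.pi) * ENNReal.ofReal (B * Real.pi)) := by
    intro t ht
    rw [Set.mem_Ioi] at ht
    rw [lintegral_const_mul _ (by fun_prop), Measure.volume_eq_prod,
      lintegral_prod_mul (by fun_prop) (by fun_prop),
      lintegral_inv_one_add_sq_scaled (by positivity) hA,
      lintegral_inv_one_add_sq_scaled (by positivity) hB]
  rw [setLIntegral_congr_fun measurableSet_Ioi hint, lintegral_mul_const _ (by fun_prop)]
  exact ENNReal.mul_lt_top (integrableOn_exp_neg_Ioi 0).lintegral_lt_top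
    (ENNReal.mul_lt_top ENNReal.ofReal_lt_top ENNReal.ofReal_lt_top)

/-- The fundamental solution K belongs to every Lᵠ(ℝ²), 1 ≤ q < ∞. -/
theorem stmt_16 (q : ℝ) (hq : 1 ≤ q) :
    ∫⁻ z : ℝ × ℝ, ENNReal.ofReal (‖Kker z.1 z.2‖ ^ q) < ⊤ := by
  obtain ⟨M, hM, h⟩ := exists_enorm_Kker_le
  have hM' : M ^ (q - 1) ≠ ⊤ := ENNReal.rpow_ne_top_of_nonneg (by linarith) hM
  calc ∫⁻ z : ℝ × ℝ, ENNReal.ofReal (‖Kker z.1 z.2‖ ^ q)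
      ≤ ∫⁻ z : ℝ × ℝ, M ^ (q - 1) * ‖Kker z.1 z.2‖ₑ := by
        refine lintegral_mono fun z => ?_
        rw [← ENNReal.ofReal_rpow_of_nonneg (norm_nonneg _) (by linarith), ofReal_norm]
        calc ‖Kker z.1 z.2‖ₑ ^ q = ‖Kker z.1 z.2‖ₑ ^ ((q - 1) + 1) := by rw [sub_add_cancel]
          _ = ‖Kker z.1 z.2‖ₑ ^ (q - 1) * ‖Kker z.1 z.2‖ₑ := by
            rw [ENNReal.rpow_add_of_nonneg _ _ (by linarith) zero_le_one, ENNReal.rpow_one]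
          _ ≤ _ := by
            gcongr
            exact h _ _
    _ = M ^ (q - 1) * ∫⁻ z : ℝ × ℝ, ‖Kker z.1 z.2‖ₑ := lintegral_const_mul' _ _ hM'
    _ < ⊤ := ENNReal.mul_lt_top hM'.lt_top lintegral_enorm_Kker_lt_top
end
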